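/- arXiv:2603.10177 — 7 statements merged into one kernel-verified Lean document; each statement's English description precedes it below -/
import Mathlib

section
/- Let H = (V, E) be a hypergraph in which every hyperedge is nonempty, and let H_1 = (V_1, E_1), …, H_t = (V_t, E_t) be its connected components. Then κ(H) = κ(H_1) + κ(H_2) + … + κ(H_t). -/
open Finset

variable {α : Type*} [DecidableEq α]

/-- Total weights achievable by fractional edge covers of the hypergraph `(V, E)`. -/
def coverWeights (V : Finset α) (E : Finset (Finset α)) : Set ℝ :=
  {w | ∃ u : Finset α → ℝ, (∀ e ∈ E, 0 ≤ u e) ∧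
    (∀ v ∈ V, 1 ≤ ∑ e ∈ E.filter (fun e => v ∈ e), u e) ∧
    w = ∑ e ∈ E, u e}

/-- Total weights achievable by fractional edge packings of the hypergraph `(V, E)`. -/
def packingWeights (V : Finset α) (E : Finset (Finset α)) : Set ℝ :=
  {w | ∃ u : Finset α → ℝ, (∀ e ∈ E, 0 ≤ u e) ∧
    (∀ v ∈ V, ∑ e ∈ E.filter (fun e => v ∈ e), u e ≤ 1) ∧
    w = ∑ e ∈ E, u e}

/-- `ρ*`: the minimum total weight of a fractional edge cover. -/
noncomputable def rhoStar (V : Finset α) (E : Finset (Finset α)) : ℝ :=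
  sInf (coverWeights V E)

/-- `τ*`: the maximum total weight of a fractional edge packing. -/
noncomputable def tauStar (V : Finset α) (E : Finset (Finset α)) : ℝ :=
  sSup (packingWeights V E)

/-- Edge set of the induced subhypergraph `H[S]`. -/
def induced (E : Finset (Finset α)) (S : Finset α) : Finset (Finset α) :=
  (E.image (fun e => e ∩ S)).filter (fun e => e ≠ ∅)

/-- Edge set of the reduced hypergraph `red(H)`: edges strictly contained in
another edge are removed. -/
def reduce (E : Finset (Finset α)) : Finset (Finset α) :=
  E.filter (fun e => ∀ e' ∈ E, e ⊆ e' → e = e')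

/-- `κ`: the reduced quasi vertex-cover. -/
noncomputable def kappa (V : Finset α) (E : Finset (Finset α)) : ℝ :=
  V.powerset.sup' V.powerset_nonempty (fun S => tauStar S (reduce (induced E S)))

/-- `ψ*`: the edge quasi-packing. -/
noncomputable def psiStar (V : Finset α) (E : Finset (Finset α)) : ℝ :=
  V.powerset.sup' V.powerset_nonempty (fun S => tauStar S (induced E S))

/-- Two vertices are connected in the hypergraph with edge set `E` if they are
related by the reflexive-transitive closure of "lying in a common hyperedge". -/
def hconn (E : Finset (Finset α)) : α → α → Prop :=
  Relation.ReflTransGen (fun u v => ∃ e ∈ E, u ∈ e ∧ v ∈ e)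

/-- Every edge of `F` is a nonempty subset of `S`. -/
def EdgesIn (S : Finset α) (F : Finset (Finset α)) : Prop :=
  ∀ e ∈ F, e.Nonempty ∧ e ⊆ S

namespace EdgesIn

theorem induced {E : Finset (Finset α)} (S : Finset α) :
    EdgesIn S (induced E S) := by
  intro e he
  simp only [_root_.induced, mem_filter, mem_image] at he
  obtain ⟨⟨e', -, rfl⟩, hne⟩ := he
  exact ⟨nonempty_iff_ne_empty.mpr hne, inter_subset_right⟩

theorem reduce {S : Finset α} {F : Finset (Finset α)} (h : EdgesIn S F) :
    EdgesIn S (reduce F) :=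
  fun e he => h e (mem_filter.mp he).1

theorem not_subset {β : Type*} {S T : Finset β} {F G : Finset (Finset β)} (hST : Disjoint S T)
    (hF : EdgesIn S F) (hG : EdgesIn T G) {e f : Finset β} (he : e ∈ F) (hf : f ∈ G) :
    ¬ e ⊆ f := by
  intro hef
  obtain ⟨x, hx⟩ := (hF e he).1
  exact disjoint_left.mp hST ((hF e he).2 hx) ((hG f hf).2 (hef hx))

theorem disjoint {β : Type*} {S T : Finset β} {F G : Finset (Finset β)} (hST : Disjoint S T)
    (hF : EdgesIn S F) (hG : EdgesIn T G) : Disjoint F G :=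
  disjoint_left.mpr fun _ he hf => not_subset hST hF hG he hf Subset.rfl

theorem filter_mem_union_left {S T : Finset α} {F G : Finset (Finset α)} (hST : Disjoint S T)
    (hG : EdgesIn T G) {v : α} (hv : v ∈ S) :
    (F ∪ G).filter (fun e => v ∈ e) = F.filter (fun e => v ∈ e) := by
  rw [filter_union, filter_false_of_mem (s := G), union_empty]
  exact fun e he hve => disjoint_left.mp hST hv ((hG e he).2 hve)

theorem filter_mem_union_right {S T : Finset α} {F G : Finset (Finset α)} (hST : Disjoint S T)
    (hF : EdgesIn S F) {v : α} (hv : v ∈ T) :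
    (F ∪ G).filter (fun e => v ∈ e) = G.filter (fun e => v ∈ e) := by
  rw [union_comm, filter_mem_union_left hST.symm hF hv]

end EdgesIn

theorem packingWeights_nonempty (S : Finset α) (F : Finset (Finset α)) :
    (packingWeights S F).Nonempty :=
  ⟨0, fun _ => 0, by simp, by simp, by simp⟩

theorem packingWeights_bddAbove {S : Finset α} {F : Finset (Finset α)} (h : EdgesIn S F) :
    BddAbove (packingWeights S F) := by
  refine ⟨F.card, ?_⟩
  rintro w ⟨u, hu, hv, rfl⟩
  rw [← nsmul_one]
  refine sum_le_card_nsmul _ _ _ fun e he => ?_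
  obtain ⟨x, hx⟩ := (h e he).1
  refine le_trans ?_ (hv x ((h e he).2 hx))
  exact single_le_sum (f := u) (fun f hf => hu f (mem_filter.mp hf).1)
    (mem_filter.mpr ⟨he, hx⟩)

open scoped Pointwise in
theorem packingWeights_union {S T : Finset α} {F G : Finset (Finset α)} (hST : Disjoint S T)
    (hF : EdgesIn S F) (hG : EdgesIn T G) :
    packingWeights (S ∪ T) (F ∪ G) = packingWeights S F + packingWeights T G := by
  have hFG := hF.disjoint hST hG
  ext w
  rw [Set.mem_add]
  constructor
  · rintro ⟨u, hu, hv, rfl⟩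
    refine ⟨_, ⟨u, fun e he => hu e (mem_union_left _ he), fun v hvS => ?_, rfl⟩,
      _, ⟨u, fun e he => hu e (mem_union_right _ he), fun v hvT => ?_, rfl⟩,
      (sum_union hFG).symm⟩
    · rw [← hG.filter_mem_union_left hST hvS]
      exact hv v (mem_union_left _ hvS)
    · rw [← hF.filter_mem_union_right hST hvT]
      exact hv v (mem_union_right _ hvT)
  · rintro ⟨_, ⟨a, ha, hav, rfl⟩, _, ⟨b, hb, hbv, rfl⟩, rfl⟩
    have hua : ∀ e ∈ F, (if e ∈ F then a e else b e) = a e := fun e he => if_pos he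
    have hub : ∀ e ∈ G, (if e ∈ F then a e else b e) = b e :=
      fun e he => if_neg (disjoint_right.mp hFG he)
    refine ⟨fun e => if e ∈ F then a e else b e, fun e he => ?_, fun v hv => ?_, ?_⟩
    · rcases mem_union.mp he with h | h
      · exact (ha e h).trans_eq (hua e h).symm
      · exact (hb e h).trans_eq (hub e h).symm
    · rcases mem_union.mp hv with h | h
      · rw [hG.filter_mem_union_left hST h,
          sum_congr rfl fun e he => hua e (mem_filter.mp he).1]
        exact hav v h
      · rw [hF.filter_mem_union_right hST h,
          sum_congr rfl fun e he => hub e (mem_filter.mp he).1]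
        exact hbv v h
    · rw [sum_union hFG, sum_congr rfl hua, sum_congr rfl hub]

theorem tauStar_union {S T : Finset α} {F G : Finset (Finset α)} (hST : Disjoint S T)
    (hF : EdgesIn S F) (hG : EdgesIn T G) :
    tauStar (S ∪ T) (F ∪ G) = tauStar S F + tauStar T G := by
  unfold tauStar
  rw [packingWeights_union hST hF hG,
    csSup_add (packingWeights_nonempty S F) (packingWeights_bddAbove hF)
      (packingWeights_nonempty T G) (packingWeights_bddAbove hG)]

theorem reduce_union {S T : Finset α} {F G : Finset (Finset α)} (hST : Disjoint S T)
    (hF : EdgesIn S F) (hG : EdgesIn T G) : reduce (F ∪ G) = reduce F ∪ reduce G := by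
  have hFG : ∀ e ∈ F, ∀ f ∈ G, ¬ e ⊆ f := fun e he f hf => hF.not_subset hST hG he hf
  have hGF : ∀ e ∈ G, ∀ f ∈ F, ¬ e ⊆ f := fun e he f hf => hG.not_subset hST.symm hF he hf
  ext e
  simp only [reduce, mem_filter, mem_union]
  grind

theorem induced_union (E₁ E₂ : Finset (Finset α)) (S : Finset α) :
    induced (E₁ ∪ E₂) S = induced E₁ S ∪ induced E₂ S := by
  simp only [induced, image_union, filter_union]

theorem induced_union_of_disjoint {V S T : Finset α} {E : Finset (Finset α)} (hE : EdgesIn V E)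
    (hT : Disjoint V T) : induced E (S ∪ T) = induced E S := by
  have h : ∀ e ∈ E, e ∩ (S ∪ T) = e ∩ S := fun e he => by
    rw [inter_union_distrib_left, disjoint_iff_inter_eq_empty.mp (hT.mono_left (hE e he).2),
      union_empty]
  rw [induced, induced, image_congr h]

theorem tauStar_reduce_induced_union {V₁ V₂ S₁ S₂ : Finset α} {E₁ E₂ : Finset (Finset α)}
    (hV : Disjoint V₁ V₂) (h₁ : EdgesIn V₁ E₁) (h₂ : EdgesIn V₂ E₂)
    (hS₁ : S₁ ⊆ V₁) (hS₂ : S₂ ⊆ V₂) :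
    tauStar (S₁ ∪ S₂) (reduce (induced (E₁ ∪ E₂) (S₁ ∪ S₂))) =
      tauStar S₁ (reduce (induced E₁ S₁)) + tauStar S₂ (reduce (induced E₂ S₂)) := by
  have hS : Disjoint S₁ S₂ := hV.mono hS₁ hS₂
  rw [induced_union, induced_union_of_disjoint h₁ (hV.mono_right hS₂), union_comm S₁ S₂,
    induced_union_of_disjoint h₂ (hV.symm.mono_right hS₁), union_comm S₂ S₁,
    reduce_union hS (.induced _) (.induced _),
    tauStar_union hS (EdgesIn.induced _).reduce (EdgesIn.induced _).reduce]

theorem tauStar_le_kappa {V S : Finset α} (E : Finset (Finset α)) (hS : S ⊆ V) :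
    tauStar S (reduce (induced E S)) ≤ kappa V E :=
  le_sup' (fun S => tauStar S (reduce (induced E S))) (mem_powerset.mpr hS)

theorem exists_kappa_eq (V : Finset α) (E : Finset (Finset α)) :
    ∃ S ⊆ V, kappa V E = tauStar S (reduce (induced E S)) := by
  obtain ⟨S, hS, h⟩ := exists_mem_eq_sup' V.powerset_nonempty
    (fun S => tauStar S (reduce (induced E S)))
  exact ⟨S, mem_powerset.mp hS, h⟩

theorem kappa_union {V₁ V₂ : Finset α} {E₁ E₂ : Finset (Finset α)} (hV : Disjoint V₁ V₂)
    (h₁ : EdgesIn V₁ E₁) (h₂ : EdgesIn V₂ E₂) :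
    kappa (V₁ ∪ V₂) (E₁ ∪ E₂) = kappa V₁ E₁ + kappa V₂ E₂ := by
  apply le_antisymm
  · obtain ⟨S, hS, h⟩ := exists_kappa_eq (V₁ ∪ V₂) (E₁ ∪ E₂)
    have hS' : S = S ∩ V₁ ∪ S ∩ V₂ := by
      rw [← inter_union_distrib_left, inter_eq_left.mpr hS]
    rw [h, hS', tauStar_reduce_induced_union hV h₁ h₂ inter_subset_right inter_subset_right]
    exact add_le_add (tauStar_le_kappa _ inter_subset_right)
      (tauStar_le_kappa _ inter_subset_right)
  · obtain ⟨S₁, hS₁, hk₁⟩ := exists_kappa_eq V₁ E₁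
    obtain ⟨S₂, hS₂, hk₂⟩ := exists_kappa_eq V₂ E₂
    rw [hk₁, hk₂, ← tauStar_reduce_induced_union hV h₁ h₂ hS₁ hS₂]
    exact tauStar_le_kappa _ (union_subset_union hS₁ hS₂)

theorem kappa_empty : kappa (∅ : Finset α) ∅ = 0 := by
  simp [kappa, tauStar, packingWeights, reduce, induced]

theorem EdgesIn.biUnion {ι : Type*} {s : Finset ι} {V : ι → Finset α}
    {E : ι → Finset (Finset α)} (hE : ∀ i ∈ s, EdgesIn (V i) (E i)) :
    EdgesIn (s.biUnion V) (s.biUnion E) := by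
  intro e he
  obtain ⟨i, hi, hei⟩ := mem_biUnion.mp he
  exact ⟨(hE i hi e hei).1, (hE i hi e hei).2.trans (subset_biUnion_of_mem V hi)⟩

theorem kappa_biUnion {ι : Type*} [DecidableEq ι] (s : Finset ι) {V : ι → Finset α}
    {E : ι → Finset (Finset α)} (hV : Pairwise fun i j => Disjoint (V i) (V j))
    (hE : ∀ i, EdgesIn (V i) (E i)) :
    kappa (s.biUnion V) (s.biUnion E) = ∑ i ∈ s, kappa (V i) (E i) := by
  induction s using Finset.induction_on with
  | empty => simpa using kappa_empty
  | insert i s hi ih =>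
    rw [biUnion_insert, biUnion_insert, sum_insert hi, ← ih]
    refine kappa_union ?_ (hE i) (.biUnion fun j _ => hE j)
    refine (disjoint_biUnion_right _ _ _).mpr fun j hj => hV ?_
    rintro rfl
    exact hi hj

theorem hconn_symm {β : Type*} {E : Finset (Finset β)} {u v : β} (h : hconn E u v) : hconn E v u :=
  have : Std.Symm fun u v => ∃ e ∈ E, u ∈ e ∧ v ∈ e :=
    ⟨fun _ _ ⟨e, he, hu, hv⟩ => ⟨e, he, hv, hu⟩⟩
  Relation.ReflTransGen.stdSymm.symm _ _ h

/-- If every hyperedge of `H = (V, E)` is nonempty and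
`H₁ = (V₁, E₁), …, H_t = (V_t, E_t)` are its connected components (each `V i` is an
equivalence class of vertices under connectivity, and `E i = {e ∈ E : e ⊆ V i}`), then
`κ(H) = κ(H₁) + ⋯ + κ(H_t)`. -/
theorem kappa_eq_sum_components (V : Finset α) (E : Finset (Finset α))
    (hE : ∀ e ∈ E, e ⊆ V) (hne : ∀ e ∈ E, e.Nonempty)
    (t : ℕ) (Vc : Fin t → Finset α)
    (hinj : Function.Injective Vc)
    (hclass : ∀ i : Fin t, ∃ v ∈ V, ∀ u, u ∈ Vc i ↔ u ∈ V ∧ hconn E v u)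
    (hall : ∀ v ∈ V, ∃ i : Fin t, ∀ u, u ∈ Vc i ↔ u ∈ V ∧ hconn E v u) :
    kappa V E = ∑ i : Fin t, kappa (Vc i) (E.filter (fun e => e ⊆ Vc i)) := by
  have hdisj : Pairwise fun i j => Disjoint (Vc i) (Vc j) := by
    intro i j hij
    rw [disjoint_left]
    intro x hxi hxj
    apply hij
    apply hinj
    obtain ⟨a, -, ha⟩ := hclass i
    obtain ⟨b, -, hb⟩ := hclass j
    have hax := ((ha x).mp hxi).2
    have hbx := ((hb x).mp hxj).2
    ext u
    rw [ha, hb]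
    exact and_congr_right fun _ => ⟨fun h => hbx.trans ((hconn_symm hax).trans h),
      fun h => hax.trans ((hconn_symm hbx).trans h)⟩
  have hVeq : V = univ.biUnion Vc := by
    ext x
    simp only [mem_biUnion, mem_univ, true_and]
    constructor
    · intro hx
      obtain ⟨i, hi⟩ := hall x hx
      exact ⟨i, (hi x).mpr ⟨hx, .refl⟩⟩
    · rintro ⟨i, hi⟩
      obtain ⟨a, -, ha⟩ := hclass i
      exact ((ha x).mp hi).1
  have hEeq : E = univ.biUnion fun i => E.filter (fun e => e ⊆ Vc i) := by
    ext e
    simp only [mem_biUnion, mem_univ, true_and, mem_filter, exists_and_left]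
    refine ⟨fun he => ⟨he, ?_⟩, fun h => h.1⟩
    obtain ⟨x, hx⟩ := hne e he
    obtain ⟨i, hi⟩ := hall x (hE e he hx)
    exact ⟨i, fun y hy => (hi y).mpr ⟨hE e he hy, .single ⟨e, he, hx, hy⟩⟩⟩
  rw [← kappa_biUnion univ hdisj fun i e he =>
    ⟨hne e (mem_filter.mp he).1, (mem_filter.mp he).2⟩, ← hVeq, ← hEeq]
end

section
/- Let H = (V, E) be a hypergraph in which every vertex belongs to at least one hyperedge. Then κ(H) ≥ ρ*(H). -/
open Finset

variable {α : Type*} [DecidableEq α]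

/-- The feasible fractional edge covers of `(V, E)`. -/
def fractionalCovers (V : Finset α) (E : Finset (Finset α)) : Set (Finset α → ℝ) :=
  {u | (∀ e ∈ E, 0 ≤ u e) ∧ ∀ v ∈ V, 1 ≤ ∑ e ∈ E.filter (fun e => v ∈ e), u e}

/-- The vertices covered with total weight exactly one. -/
noncomputable def tightVertices (V : Finset α) (E : Finset (Finset α)) (u : Finset α → ℝ) :
    Finset α :=
  V.filter (fun v => ∑ e ∈ E.filter (fun e => v ∈ e), u e = 1)

theorem exists_optimal_cover (V : Finset α) (E : Finset (Finset α))
    (hcov : ∀ v ∈ V, ∃ e ∈ E, v ∈ e) :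
    ∃ u ∈ fractionalCovers V E, ∀ w ∈ fractionalCovers V E, ∑ e ∈ E, u e ≤ ∑ e ∈ E, w e := by
  let K : Set (Finset α → ℝ) := (Set.univ.pi fun _ => Set.Icc (0 : ℝ) 1) ∩
    ⋂ v ∈ V, {u | 1 ≤ ∑ e ∈ E.filter (fun e => v ∈ e), u e}
  have hK : IsCompact K := by
    refine (isCompact_univ_pi fun _ => isCompact_Icc).inter_right ?_
    refine isClosed_biInter fun v _ => isClosed_le continuous_const ?_
    fun_prop
  have truncate : ∀ w : Finset α → ℝ, w ∈ fractionalCovers V E →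
      (fun e => max 0 (min (w e) 1)) ∈ K := by
    intro w hw
    refine ⟨fun e _ => ⟨le_max_left _ _, by simp⟩, ?_⟩
    simp only [Set.mem_iInter, Set.mem_ofPred_eq]
    intro v hv
    by_cases h : ∃ e ∈ E.filter (fun e => v ∈ e), 1 ≤ w e
    · obtain ⟨e, he, h1⟩ := h
      refine le_trans (by simp [h1]) (single_le_sum (f := fun e => max 0 (min (w e) 1))
        (fun i _ => le_max_left _ _) he)
    · push Not at h
      refine (hw.2 v hv).trans (sum_le_sum fun e he => ?_)
      rw [min_eq_left (h e he).le]
      exact le_max_right _ _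
  have hne : K.Nonempty := by
    refine ⟨_, truncate (fun _ => 1) ⟨fun _ _ => zero_le_one, fun v hv => ?_⟩⟩
    obtain ⟨e, he, hve⟩ := hcov v hv
    exact single_le_sum (f := fun _ : Finset α => (1 : ℝ)) (fun _ _ => zero_le_one)
      (mem_filter.2 ⟨he, hve⟩)
  obtain ⟨u, hu, hmin⟩ := hK.exists_isMinOn hne
    (f := fun u => ∑ e ∈ E, u e) (by fun_prop)
  refine ⟨u, ⟨fun e _ => (hu.1 e trivial).1, fun v hv => ?_⟩, fun w hw => ?_⟩
  · exact (Set.mem_iInter₂.1 hu.2) v hv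
  · refine (hmin (truncate w hw)).trans (sum_le_sum fun e he => ?_)
    exact max_le (hw.1 e he) (min_le_left _ _)

/-- Move weight `s` away from `e` and add weight `t` to `f`. -/
def shiftWeight (u : Finset α → ℝ) (e f : Finset α) (s t : ℝ) : Finset α → ℝ :=
  fun a => u a - (if a = e then s else 0) + (if a = f then t else 0)

theorem sum_shiftWeight (A : Finset (Finset α)) (u : Finset α → ℝ) (e f : Finset α) (s t : ℝ) :
    ∑ a ∈ A, shiftWeight u e f s t a =
      ∑ a ∈ A, u a - (if e ∈ A then s else 0) + (if f ∈ A then t else 0) := by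
  simp [shiftWeight, sum_add_distrib, sum_sub_distrib]

theorem exists_slack (V : Finset α) (E : Finset (Finset α)) (u : Finset α → ℝ)
    (hu : u ∈ fractionalCovers V E) {e : Finset α} (he : 0 < u e) :
    ∃ ε > 0, ε ≤ u e ∧ ∀ v ∈ V, v ∉ tightVertices V E u →
      1 + ε < ∑ a ∈ E.filter (fun a => v ∈ a), u a := by
  have key : ∀ᶠ ε in nhdsWithin (0 : ℝ) (Set.Ioi 0), ε ≤ u e ∧
      ∀ v ∈ V, v ∉ tightVertices V E u →
        1 + ε < ∑ a ∈ E.filter (fun a => v ∈ a), u a := by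
    refine nhdsWithin_le_nhds (Filter.Eventually.and (eventually_le_nhds he) ?_)
    rw [Filter.eventually_all_finset]
    intro v hv
    by_cases hT : v ∈ tightVertices V E u
    · simp [hT]
    have hlt : 1 < ∑ a ∈ E.filter (fun a => v ∈ a), u a :=
      lt_of_le_of_ne (hu.2 v hv) fun h => hT (mem_filter.2 ⟨hv, h.symm⟩)
    filter_upwards [eventually_lt_nhds (sub_pos.2 hlt)] with ε hε _
    linarith
  obtain ⟨ε, h, hpos⟩ := (key.and self_mem_nhdsWithin).exists
  exact ⟨ε, hpos, h⟩

theorem shiftWeight_nonneg {E : Finset (Finset α)} {u : Finset α → ℝ}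
    (hu : ∀ a ∈ E, 0 ≤ u a) (e f : Finset α) {s t : ℝ} (hs : s ≤ u e) (ht : 0 ≤ t) :
    ∀ a ∈ E, 0 ≤ shiftWeight u e f s t a := by
  intro a ha
  have h := hu a ha
  unfold shiftWeight
  split_ifs with h1 h2 h2 <;> subst_vars <;> linarith

/-- In an optimal cover, every edge of positive weight meets the tight vertices. -/
theorem inter_tightVertices_ne_empty {V : Finset α} {E : Finset (Finset α)} {u : Finset α → ℝ}
    (hu : u ∈ fractionalCovers V E)
    (hopt : ∀ w ∈ fractionalCovers V E, ∑ e ∈ E, u e ≤ ∑ e ∈ E, w e)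
    {e : Finset α} (he : e ∈ E) (hpos : 0 < u e) : e ∩ tightVertices V E u ≠ ∅ := by
  intro hempty
  obtain ⟨ε, hε, hle, hslack⟩ := exists_slack V E u hu hpos
  have h := hopt (shiftWeight u e e ε 0)
    ⟨shiftWeight_nonneg hu.1 e e hle le_rfl, fun v hv => ?_⟩
  · rw [sum_shiftWeight] at h
    simp only [he, if_true] at h
    linarith
  · rw [sum_shiftWeight]
    by_cases hT : v ∈ tightVertices V E u
    · have hve : v ∉ e := fun hve => by
        have := mem_inter.2 ⟨hve, hT⟩
        simp [hempty] at this
      simpa [hve] using hu.2 v hv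
    · have := hslack v hv hT
      split_ifs <;> linarith

/-- In an optimal cover with the fewest tight vertices, the edges of positive weight have
maximal traces on the tight vertices. -/
theorem inter_tightVertices_eq_of_subset {V : Finset α} {E : Finset (Finset α)}
    {u : Finset α → ℝ} (hu : u ∈ fractionalCovers V E)
    (hmin : ∀ w ∈ fractionalCovers V E, ∑ e ∈ E, w e = ∑ e ∈ E, u e →
      #(tightVertices V E u) ≤ #(tightVertices V E w))
    {e f : Finset α} (he : e ∈ E) (hf : f ∈ E) (hpos : 0 < u e)
    (hsub : e ∩ tightVertices V E u ⊆ f ∩ tightVertices V E u) :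
    e ∩ tightVertices V E u = f ∩ tightVertices V E u := by
  by_contra hne
  obtain ⟨x, hxf, hxe⟩ := exists_of_ssubset (hsub.ssubset_of_ne hne)
  obtain ⟨ε, hε, hle, hslack⟩ := exists_slack V E u hu hpos
  have himp : ∀ v ∈ tightVertices V E u, v ∈ e → v ∈ f := fun v hT hve =>
    (mem_inter.1 (hsub (mem_inter.2 ⟨hve, hT⟩))).1
  have hw : shiftWeight u e f ε ε ∈ fractionalCovers V E := by
    refine ⟨shiftWeight_nonneg hu.1 e f hle hε.le, fun v hv => ?_⟩
    rw [sum_shiftWeight]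
    have h1 := hu.2 v hv
    by_cases hT : v ∈ tightVertices V E u
    · have := himp v hT
      simp only [mem_filter, he, hf, true_and]
      split_ifs <;> first | linarith | tauto
    · have := hslack v hv hT
      split_ifs <;> linarith
  have hsum : ∑ a ∈ E, shiftWeight u e f ε ε a = ∑ a ∈ E, u a := by
    simp [sum_shiftWeight, he, hf]
  refine absurd (hmin _ hw hsum) (not_le.2 (card_lt_card ?_))
  have hload : ∀ v, v ∈ tightVertices V E (shiftWeight u e f ε ε) ↔ v ∈ V ∧
      ∑ a ∈ E.filter (fun a => v ∈ a), u a - (if v ∈ e then ε else 0)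
        + (if v ∈ f then ε else 0) = 1 := by
    intro v
    simp [tightVertices, sum_shiftWeight, he, hf]
  refine (ssubset_iff_of_subset fun v hv => ?_).2 ⟨x, (mem_inter.1 hxf).2, fun hx => ?_⟩
  · obtain ⟨hvV, hv1⟩ := (hload v).1 hv
    by_contra hT
    have := hslack v hvV hT
    split_ifs at hv1 <;> linarith
  · obtain ⟨-, hx1⟩ := (hload x).1 hx
    obtain ⟨hxf, hxT⟩ := mem_inter.1 hxf
    have hxe' : x ∉ e := fun h => hxe (mem_inter.2 ⟨h, hxT⟩)
    have := (mem_filter.1 hxT).2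
    rw [if_neg hxe', if_pos hxf] at hx1
    linarith

theorem bddAbove_packingWeights (S : Finset α) (F : Finset (Finset α))
    (hF : ∀ f ∈ F, (f ∩ S).Nonempty) : BddAbove (packingWeights S F) := by
  refine ⟨#S, ?_⟩
  rintro _ ⟨u, hu, hpack, rfl⟩
  calc ∑ f ∈ F, u f ≤ ∑ f ∈ F, ∑ v ∈ S, if v ∈ f then u f else 0 := by
        refine sum_le_sum fun f hf => ?_
        obtain ⟨v, hv⟩ := hF f hf
        obtain ⟨hvf, hvS⟩ := mem_inter.1 hv
        refine le_trans (by simp [hvf]) (single_le_sum (f := fun v => if v ∈ f then u f else 0)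
          (fun i _ => ?_) hvS)
        split_ifs
        exacts [hu f hf, le_rfl]
    _ = ∑ v ∈ S, ∑ f ∈ F.filter (fun f => v ∈ f), u f := by
        rw [sum_comm]
        simp only [sum_filter]
    _ ≤ ∑ _v ∈ S, (1 : ℝ) := sum_le_sum hpack
    _ = #S := by simp

/-- If every vertex of `H = (V, E)` belongs to at least one hyperedge,
then `κ(H) ≥ ρ*(H)`. -/
theorem kappa_ge_rhoStar (V : Finset α) (E : Finset (Finset α))
    (hE : ∀ e ∈ E, e ⊆ V) (hcov : ∀ v ∈ V, ∃ e ∈ E, v ∈ e) :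
    rhoStar V E ≤ kappa V E := by
  obtain ⟨u₀, hu₀, hopt₀⟩ := exists_optimal_cover V E hcov
  obtain ⟨u, ⟨hu, hopt⟩, hmin⟩ := (measure fun u => #(tightVertices V E u)).wf.has_min
    {u | u ∈ fractionalCovers V E ∧ ∀ w ∈ fractionalCovers V E, ∑ e ∈ E, u e ≤ ∑ e ∈ E, w e}
    ⟨u₀, hu₀, hopt₀⟩
  set S := tightVertices V E u with hS
  set F := reduce (induced E S) with hF
  have hmem : ∀ f ∈ F, (f ∩ S).Nonempty := by
    intro f hf
    obtain ⟨hf, hne⟩ := mem_filter.1 (mem_filter.1 hf).1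
    obtain ⟨e, -, rfl⟩ := mem_image.1 hf
    rw [inter_assoc, inter_self]
    exact nonempty_iff_ne_empty.2 hne
  have htrace : ∀ e ∈ E, u e ≠ 0 → e ∩ S ∈ F := by
    intro e he h0
    have hpos : 0 < u e := (hu.1 e he).lt_of_ne' h0
    refine mem_filter.2 ⟨mem_filter.2 ⟨mem_image_of_mem _ he,
      inter_tightVertices_ne_empty hu hopt he hpos⟩, fun f' hf' hsub => ?_⟩
    obtain ⟨f, hf, rfl⟩ := mem_image.1 (mem_filter.1 hf').1
    refine inter_tightVertices_eq_of_subset hu (fun w hw hsum => ?_) he hf hpos hsub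
    exact not_lt.1 (hmin w ⟨hw, fun w' hw' => hsum.le.trans (hopt w' hw')⟩)
  let p : Finset α → ℝ := fun f => ∑ e ∈ E.filter (fun e => e ∩ S = f), u e
  have hp : ∑ e ∈ E, u e ∈ packingWeights S F := by
    refine ⟨p, fun f _ => sum_nonneg fun e he => hu.1 e (mem_filter.1 he).1, fun v hv => ?_, ?_⟩
    · refine le_of_le_of_eq ?_ (mem_filter.1 hv).2
      calc ∑ f ∈ F.filter (fun f => v ∈ f), p f
          = ∑ f ∈ F.filter (fun f => v ∈ f),
              ∑ e ∈ (E.filter (fun e => v ∈ e)).filter (fun e => e ∩ S = f), u e := by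
            refine sum_congr rfl fun f hf => sum_congr ?_ fun _ _ => rfl
            ext e
            simp only [mem_filter]
            constructor
            · rintro ⟨he, rfl⟩
              exact ⟨⟨he, (mem_inter.1 (mem_filter.1 hf).2).1⟩, rfl⟩
            · rintro ⟨⟨he, -⟩, h⟩
              exact ⟨he, h⟩
        _ ≤ ∑ e ∈ E.filter (fun e => v ∈ e), u e :=
            sum_fiberwise_le_sum_of_sum_fiber_nonneg fun f _ =>
              sum_nonneg fun e he => hu.1 e (mem_filter.1 (mem_filter.1 he).1).1
    · rw [← sum_filter_ne_zero (s := E)]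
      rw [← sum_fiberwise_of_maps_to (t := F) (g := fun e => e ∩ S)
        (fun e he => htrace e (mem_filter.1 he).1 (mem_filter.1 he).2)]
      refine sum_congr rfl fun f _ => ?_
      rw [filter_comm, sum_filter_ne_zero]
  calc rhoStar V E ≤ ∑ e ∈ E, u e := by
        refine csInf_le ⟨0, ?_⟩ ⟨u, hu.1, hu.2, rfl⟩
        rintro _ ⟨w, hw, -, rfl⟩
        exact sum_nonneg hw
    _ ≤ tauStar S F := le_csSup (bddAbove_packingWeights S F hmem) hp
    _ ≤ kappa V E := le_sup' (fun S => tauStar S (reduce (induced E S)))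
        (mem_powerset.2 (filter_subset _ _))
end

section
/- Let H = (V, E) be an acyclic hypergraph (i.e., H admits a join tree) in which every vertex belongs to at least one hyperedge. Then κ(H) = ρ*(H). -/
open Finset

variable {α : Type*} [DecidableEq α]

namespace SimpleGraph

variable {N : Type*} {T : SimpleGraph N} {r : N}

/-- In the graph `T` rooted at `r`, the node `b` is a neighbour of `a` closer to the root. -/
def IsParent (T : SimpleGraph N) (r a b : N) : Prop :=
  T.Adj a b ∧ T.dist r b < T.dist r a

/-- The node `e` belongs to `A` and none of its parents does. -/
def IsTop (T : SimpleGraph N) (r : N) (A : Set N) (e : N) : Prop :=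
  e ∈ A ∧ ∀ p, T.IsParent r e p → p ∉ A

/-- The node `b` is an ancestor of `a` (possibly `a` itself) in the graph `T` rooted at `r`. -/
abbrev IsAncestor (T : SimpleGraph N) (r : N) : N → N → Prop :=
  Relation.ReflTransGen (T.IsParent r)

lemma IsTree.isParent_or_isParent (hT : T.IsTree) (r : N) {a b : N} (h : T.Adj a b) :
    T.IsParent r a b ∨ T.IsParent r b a := by
  rcases lt_or_gt_of_ne (hT.dist_ne_of_adj r h) with hlt | hlt
  · exact Or.inr ⟨h.symm, hlt⟩
  · exact Or.inl ⟨h, hlt⟩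

lemma IsTree.rightUnique_isParent (hT : T.IsTree) (r : N) :
    Relator.RightUnique (T.IsParent r) := by
  classical
  intro a b c hb hc
  obtain ⟨p, hp⟩ := (hT.connected r a).exists_isPath
  have key : ∀ x, T.IsParent r a x → x = p.penultimate := by
    rintro x ⟨hadj, hlt⟩
    obtain ⟨q, hq, hlen⟩ := hT.connected.exists_path_of_dist r x
    have ha : a ∉ q.support := fun hmem => by
      have h₁ := T.dist_le (q.takeUntil a hmem)
      have h₂ := q.length_takeUntil_le_length hmem
      omega
    exact hT.isAcyclic.eq_penultimate_of_adj_end hp hadj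
      (hT.isAcyclic.mem_support_of_ne_mem_support_of_adj_of_isPath hp hq hadj ha)
  rw [key b hb, key c hc]

lemma IsAncestor.dist_le {a b : N} (h : T.IsAncestor r a b) : T.dist r b ≤ T.dist r a := by
  induction h with
  | refl => exact le_rfl
  | tail _ hbc ih => exact hbc.2.le.trans ih

lemma IsAncestor.eq_of_dist_le {a b : N} (h : T.IsAncestor r a b)
    (hd : T.dist r a ≤ T.dist r b) : a = b := by
  rcases Relation.ReflTransGen.cases_head h with rfl | ⟨c, hac, hcb⟩
  · rfl
  · have h₁ := hac.2
    have h₂ := IsAncestor.dist_le hcb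
    omega

/-- The top node of a connected set of nodes is an ancestor of every node of the set. -/
lemma IsTop.isAncestor (hT : T.IsTree) {A : Set N} (hA : (T.induce A).Connected) {e f : N}
    (he : T.IsTop r A e) (hf : f ∈ A) : T.IsAncestor r f e := by
  have hreach : Relation.ReflTransGen (T.induce A).Adj ⟨e, he.1⟩ ⟨f, hf⟩ :=
    (SimpleGraph.reachable_iff_reflTransGen _ _).1 (hA ⟨e, he.1⟩ ⟨f, hf⟩)
  suffices ∀ x : A, Relation.ReflTransGen (T.induce A).Adj ⟨e, he.1⟩ x → T.IsAncestor r x e from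
    this _ hreach
  intro x hx
  induction hx with
  | refl => exact .refl
  | @tail x y _ hxy ih =>
    have hadj : T.Adj x y := hxy
    rcases hT.isParent_or_isParent r hadj with h | h
    · rcases Relation.ReflTransGen.cases_head ih with heq | ⟨c, hxc, hce⟩
      · exact absurd y.2 (he.2 _ (heq ▸ h))
      · rwa [hT.rightUnique_isParent r h hxc]
    · exact .head h ih

/-- A connected set contains every node lying between one of its nodes and its top node. -/
lemma IsTop.mem_of_isAncestor (hT : T.IsTree) {A : Set N} (hA : (T.induce A).Connected)
    {t f e : N} (ht : T.IsTop r A t) (hf : f ∈ A) (hfe : T.IsAncestor r f e)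
    (het : T.IsAncestor r e t) : e ∈ A := by
  induction hfe with
  | refl => exact hf
  | @tail x y _ hxy ih =>
    have hx : x ∈ A := ih (.head hxy het)
    by_contra hy
    have htop : T.IsTop r A x :=
      ⟨hx, fun p hp => by rwa [hT.rightUnique_isParent r hp hxy]⟩
    have h₁ := IsAncestor.dist_le (htop.isAncestor hT hA ht.1)
    have h₂ := IsAncestor.dist_le het
    have h₃ := hxy.2
    omega

lemma exists_isTop (T : SimpleGraph N) (r : N) {A : Set N} (hA : A.Nonempty) :
    ∃ e, T.IsTop r A e := by
  obtain ⟨e, he, hmin⟩ := exists_minimalFor_of_wellFoundedLT (· ∈ A) (T.dist r) hA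
  exact ⟨e, he, fun p hp hpA => (hmin hpA hp.2.le).not_gt hp.2⟩

/-- If two connected sets meet and the top node of the first is at least as deep as that of the
second, then the top node of the first belongs to the second. -/
lemma IsTop.mem_of_dist_le (hT : T.IsTree) {A B : Set N} (hA : (T.induce A).Connected)
    (hB : (T.induce B).Connected) {a b f : N} (ha : T.IsTop r A a) (hb : T.IsTop r B b)
    (hfA : f ∈ A) (hfB : f ∈ B) (hd : T.dist r b ≤ T.dist r a) : a ∈ B := by
  have hfa := ha.isAncestor hT hA hfA
  have hfb := hb.isAncestor hT hB hfB
  rcases Relation.ReflTransGen.total_of_right_unique (hT.rightUnique_isParent r) hfa hfb with h | h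
  · exact hb.mem_of_isAncestor hT hB hfB hfa h
  · exact IsAncestor.eq_of_dist_le h hd ▸ hb.1

end SimpleGraph

section JoinTree

variable {V : Finset α} {E : Finset (Finset α)} {T : SimpleGraph {e // e ∈ E}}

/-- A hyperedge of the reduced induced subhypergraph is the trace of a hyperedge that is the top
node of one of the vertices in the trace. -/
lemma exists_isTop_of_mem_reduce_induced (hT : T.IsTree) (r : {e // e ∈ E})
    {S e' : Finset α} (he' : e' ∈ reduce (induced E S)) :
    ∃ e : {e // e ∈ E}, ∃ v, e.1 ∩ S = e' ∧ v ∈ e' ∧ T.IsTop r {f | v ∈ f.1} e := by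
  obtain ⟨hind, hmax⟩ := Finset.mem_filter.1 he'
  obtain ⟨himg, hne⟩ := Finset.mem_filter.1 hind
  obtain ⟨e₀, he₀, heq₀⟩ := Finset.mem_image.1 himg
  have hex : {e : {e // e ∈ E} | e.1 ∩ S = e'}.Nonempty := ⟨⟨e₀, he₀⟩, heq₀⟩
  obtain ⟨e, he, hmin⟩ := exists_minimalFor_of_wellFoundedLT
    (· ∈ {e : {e // e ∈ E} | e.1 ∩ S = e'}) (T.dist r) hex
  by_cases hp : ∃ p, T.IsParent r e p
  · obtain ⟨p, hp⟩ := hp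
    have hnot : ¬ e' ⊆ p.1 := fun hsub => by
      have hsub' : e' ⊆ p.1 ∩ S :=
        Finset.subset_inter hsub (he ▸ Finset.inter_subset_right)
      have hpS : p.1 ∩ S ∈ induced E S :=
        Finset.mem_filter.2 ⟨Finset.mem_image_of_mem _ p.2,
          fun h => hne (Finset.subset_empty.1 (h ▸ hsub'))⟩
      exact (hmin (hmax _ hpS hsub').symm hp.2.le).not_gt hp.2
    obtain ⟨v, hv, hvp⟩ := Finset.not_subset.1 hnot
    refine ⟨e, v, he, hv, ?_, fun q hq => ?_⟩
    · exact Finset.mem_of_mem_inter_left (he.symm ▸ hv)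
    · rwa [hT.rightUnique_isParent r hq hp]
  · obtain ⟨v, hv⟩ := Finset.nonempty_iff_ne_empty.2 hne
    refine ⟨e, v, he, hv, ?_, fun p hp' => absurd ⟨p, hp'⟩ hp⟩
    exact Finset.mem_of_mem_inter_left (he.symm ▸ hv)

/-- In an acyclic hypergraph, a fractional packing of a reduced induced subhypergraph weighs at
most as much as a fractional edge cover. -/
lemma packingWeights_le_coverWeights (hT : T.IsTree)
    (hjoin : ∀ v ∈ V, (T.induce {e : {e // e ∈ E} | v ∈ e.1}).Connected)
    {S : Finset α} (hS : S ⊆ V) {w c : ℝ}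
    (hw : w ∈ packingWeights S (reduce (induced E S))) (hc : c ∈ coverWeights V E) :
    w ≤ c := by
  classical
  obtain ⟨u, hu0, hu1, rfl⟩ := hw
  obtain ⟨y, hy0, hy1, rfl⟩ := hc
  obtain ⟨r⟩ := hT.connected.nonempty
  obtain hem | ⟨e₀, he₀⟩ := (reduce (induced E S)).eq_empty_or_nonempty
  · rw [hem, Finset.sum_empty]
    exact Finset.sum_nonneg hy0
  obtain ⟨-, v₀, -⟩ := exists_isTop_of_mem_reduce_induced hT r he₀
  have : Nonempty α := ⟨v₀⟩
  have : Nonempty {e // e ∈ E} := ⟨r⟩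
  choose! t v ht hv htop using
    fun e' (he' : e' ∈ reduce (induced E S)) => exists_isTop_of_mem_reduce_induced hT r he'
  have hsub : ∀ e' ∈ reduce (induced E S), e' ⊆ S := fun e' he' =>
    ht e' he' ▸ Finset.inter_subset_right
  have hgroup : ∀ f ∈ E, ∑ e' ∈ reduce (induced E S) with v e' ∈ f, u e' ≤ 1 := by
    intro f hf
    obtain hem | hne :=
      ((reduce (induced E S)).filter (fun e' => v e' ∈ f)).eq_empty_or_nonempty
    · simp [hem]
    obtain ⟨m, hm, hmin⟩ := Finset.exists_min_image _ (fun e' => T.dist r (t e')) hne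
    obtain ⟨hm, hmf⟩ := Finset.mem_filter.1 hm
    have hmS := hsub m hm (hv m hm)
    refine le_trans (Finset.sum_le_sum_of_subset_of_nonneg ?_ ?_) (hu1 (v m) hmS)
    · intro e' he'
      have hd := hmin e' he'
      obtain ⟨he', hef⟩ := Finset.mem_filter.1 he'
      refine Finset.mem_filter.2 ⟨he', ?_⟩
      have hmem := (htop e' he').mem_of_dist_le hT (hjoin _ (hS (hsub e' he' (hv e' he'))))
        (hjoin _ (hS hmS)) (htop m hm) (f := ⟨f, hf⟩) hef hmf hd
      rw [← ht e' he']
      exact Finset.mem_inter.2 ⟨hmem, hmS⟩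
    · exact fun e' he' _ => hu0 e' (Finset.mem_filter.1 he').1
  calc ∑ e' ∈ reduce (induced E S), u e'
      ≤ ∑ e' ∈ reduce (induced E S), ∑ f ∈ E with v e' ∈ f, u e' * y f := by
        refine Finset.sum_le_sum fun e' he' => ?_
        rw [← Finset.mul_sum]
        exact le_mul_of_one_le_right (hu0 e' he') (hy1 _ (hS (hsub e' he' (hv e' he'))))
    _ = ∑ f ∈ E, ∑ e' ∈ reduce (induced E S) with v e' ∈ f, u e' * y f := by
        simp only [Finset.sum_filter]
        exact Finset.sum_comm
    _ ≤ ∑ f ∈ E, y f := by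
        refine Finset.sum_le_sum fun f hf => ?_
        rw [← Finset.sum_mul]
        exact mul_le_of_le_one_left (hy0 f hf) (hgroup f hf)

/-- In an acyclic hypergraph, every set of vertices has a subset of pairwise non-adjacent vertices
that is at least as large as some cover of the set by hyperedges. -/
lemma exists_independent_card_ge_cover (hcov : ∀ v ∈ V, ∃ e ∈ E, v ∈ e) (hT : T.IsTree)
    (hjoin : ∀ v ∈ V, (T.induce {e : {e // e ∈ E} | v ∈ e.1}).Connected)
    (W : Finset α) (hW : W ⊆ V) :
    ∃ I ⊆ W, ∃ C ⊆ E, (∀ e ∈ E, ∀ a ∈ I, ∀ b ∈ I, a ∈ e → b ∈ e → a = b) ∧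
      (∀ v ∈ W, ∃ e ∈ C, v ∈ e) ∧ #C ≤ #I := by
  classical
  obtain ⟨r⟩ := hT.connected.nonempty
  have hex : ∀ v ∈ V, ∃ e, T.IsTop r {f : {e // e ∈ E} | v ∈ f.1} e := fun v hv => by
    obtain ⟨e, he, hve⟩ := hcov v hv
    exact T.exists_isTop r ⟨⟨e, he⟩, hve⟩
  have : Nonempty {e // e ∈ E} := ⟨r⟩
  choose! t ht using hex
  induction W using Finset.strongInduction with
  | H W ih =>
    obtain rfl | hne := W.eq_empty_or_nonempty
    · exact ⟨∅, subset_rfl, ∅, Finset.empty_subset _, by simp⟩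
    obtain ⟨v, hv, hmax⟩ := Finset.exists_max_image W (fun v => T.dist r (t v)) hne
    have hvt : v ∈ (t v).1 := (ht v (hW hv)).1
    have hss : W \ (t v).1 ⊂ W :=
      ⟨Finset.sdiff_subset, fun h => (Finset.mem_sdiff.1 (h hv)).2 hvt⟩
    obtain ⟨I, hI, C, hC, hind, hcover, hcard⟩ := ih _ hss (hss.1.trans hW)
    have hvI : v ∉ I := fun h => (Finset.mem_sdiff.1 (hI h)).2 hvt
    have hfar : ∀ e ∈ E, ∀ a ∈ I, v ∈ e → a ∈ e → False := fun e he a ha hve hae => by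
      obtain ⟨haW, hat⟩ := Finset.mem_sdiff.1 (hI ha)
      exact hat ((ht v (hW hv)).mem_of_dist_le hT (hjoin _ (hW hv)) (hjoin _ (hW haW))
        (ht a (hW haW)) (f := ⟨e, he⟩) hve hae (hmax a haW))
    refine ⟨insert v I, Finset.insert_subset hv (hI.trans hss.1), insert (t v).1 C,
      Finset.insert_subset (t v).2 hC, ?_, ?_, ?_⟩
    · intro e he a ha b hb hae hbe
      rcases Finset.mem_insert.1 ha with rfl | ha' <;>
        rcases Finset.mem_insert.1 hb with rfl | hb'
      · rfl
      · exact (hfar e he b hb' hae hbe).elim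
      · exact (hfar e he a ha' hbe hae).elim
      · exact hind e he a ha' b hb' hae hbe
    · intro w hw
      by_cases hwt : w ∈ (t v).1
      · exact ⟨_, Finset.mem_insert_self _ _, hwt⟩
      · obtain ⟨e, he, hwe⟩ := hcover w (Finset.mem_sdiff.2 ⟨hw, hwt⟩)
        exact ⟨e, Finset.mem_insert_of_mem he, hwe⟩
    · rw [Finset.card_insert_of_notMem hvI]
      exact (Finset.card_insert_le _ _).trans (by omega)

end JoinTree

lemma card_mem_coverWeights {V : Finset α} {E C : Finset (Finset α)} (hC : C ⊆ E)
    (hcover : ∀ v ∈ V, ∃ e ∈ C, v ∈ e) : (#C : ℝ) ∈ coverWeights V E := by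
  refine ⟨fun e => if e ∈ C then 1 else 0, fun e _ => by positivity, fun v hv => ?_, ?_⟩
  · obtain ⟨e, he, hve⟩ := hcover v hv
    have h := Finset.single_le_sum (f := fun e => if e ∈ C then (1 : ℝ) else 0)
      (s := E.filter (fun e => v ∈ e)) (fun e _ => by positivity)
      (Finset.mem_filter.2 ⟨hC he, hve⟩)
    simpa [he] using h
  · simp [Finset.sum_ite_mem, Finset.inter_eq_right.2 hC]

/-- Inducing on a set of pairwise non-adjacent vertices leaves only singletons. -/
lemma reduce_induced_eq_image_singleton {E : Finset (Finset α)} {I : Finset α}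
    (hcov : ∀ v ∈ I, ∃ e ∈ E, v ∈ e)
    (hind : ∀ e ∈ E, ∀ a ∈ I, ∀ b ∈ I, a ∈ e → b ∈ e → a = b) :
    reduce (induced E I) = I.image ({·}) := by
  have hinter : ∀ e ∈ E, ∀ v ∈ I, v ∈ e → e ∩ I = {v} := fun e he v hv hve => by
    ext a
    simp only [Finset.mem_inter, Finset.mem_singleton]
    exact ⟨fun h => hind e he a h.2 v hv h.1 hve, by rintro rfl; exact ⟨hve, hv⟩⟩
  have hinduced : induced E I = I.image ({·}) := by
    ext s
    simp only [induced, Finset.mem_filter, Finset.mem_image]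
    constructor
    · rintro ⟨⟨e, he, rfl⟩, hne⟩
      obtain ⟨v, hv⟩ := Finset.nonempty_iff_ne_empty.2 hne
      obtain ⟨hve, hvI⟩ := Finset.mem_inter.1 hv
      exact ⟨v, hvI, (hinter e he v hvI hve).symm⟩
    · rintro ⟨v, hv, rfl⟩
      obtain ⟨e, he, hve⟩ := hcov v hv
      exact ⟨⟨e, he, hinter e he v hv hve⟩, Finset.singleton_ne_empty v⟩
  rw [reduce, hinduced, Finset.filter_eq_self]
  simp

lemma card_mem_packingWeights_image_singleton (I : Finset α) :
    (#I : ℝ) ∈ packingWeights I (I.image ({·})) := by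
  refine ⟨fun _ => 1, fun _ _ => zero_le_one, fun v _ => ?_, ?_⟩
  · rw [Finset.sum_const, nsmul_one]
    refine Nat.cast_le_one.2 (Finset.card_le_one.2 fun a ha b hb => ?_)
    simp only [Finset.mem_filter, Finset.mem_image] at ha hb
    obtain ⟨⟨x, -, rfl⟩, hx⟩ := ha
    obtain ⟨⟨y, -, rfl⟩, hy⟩ := hb
    rw [← Finset.mem_singleton.1 hx, ← Finset.mem_singleton.1 hy]
  · rw [Finset.sum_const, nsmul_one, Finset.card_image_of_injective _ Finset.singleton_injective]

/-- If `H = (V, E)` is an acyclic hypergraph (it admits a join tree: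
a tree `T` on the hyperedges such that for every vertex the hyperedges containing it
induce a connected subtree) and every vertex belongs to at least one hyperedge,
then `κ(H) = ρ*(H)`. -/
theorem kappa_eq_rhoStar_of_acyclic (V : Finset α) (E : Finset (Finset α))
    (hE : ∀ e ∈ E, e ⊆ V) (hcov : ∀ v ∈ V, ∃ e ∈ E, v ∈ e)
    (T : SimpleGraph {e // e ∈ E}) (hT : T.IsTree)
    (hjoin : ∀ v ∈ V, (T.induce {e : {e // e ∈ E} | v ∈ e.1}).Connected) :
    kappa V E = rhoStar V E := by
  have hle : ∀ S ⊆ V, ∀ w ∈ packingWeights S (reduce (induced E S)), ∀ c ∈ coverWeights V E,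
      w ≤ c := fun S hS w hw c hc => packingWeights_le_coverWeights hT hjoin hS hw hc
  obtain ⟨I, hI, C, hC, hind, hcover, hcard⟩ :=
    exists_independent_card_ge_cover hcov hT hjoin V subset_rfl
  have hCmem := card_mem_coverWeights hC hcover
  apply le_antisymm
  · refine Finset.sup'_le _ _ fun S hS => ?_
    have hSV := Finset.mem_powerset.1 hS
    refine csSup_le ⟨0, 0, by simp⟩ fun w hw => le_csInf ⟨_, hCmem⟩ fun c hc => hle S hSV w hw c hc
  · have hImem : (#I : ℝ) ∈ packingWeights I (reduce (induced E I)) := by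
      rw [reduce_induced_eq_image_singleton (fun v hv => hcov v (hI hv)) hind]
      exact card_mem_packingWeights_image_singleton I
    have hbelow : BddBelow (coverWeights V E) := ⟨_, fun c hc => hle I hI _ hImem c hc⟩
    have habove : BddAbove (packingWeights I (reduce (induced E I))) :=
      ⟨_, fun w hw => hle I hI w hw _ hCmem⟩
    calc rhoStar V E ≤ #C := csInf_le hbelow hCmem
      _ ≤ #I := Nat.cast_le.2 hcard
      _ ≤ tauStar I (reduce (induced E I)) := le_csSup habove hImem
      _ ≤ kappa V E := Finset.le_sup' (fun S => tauStar S (reduce (induced E S)))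
          (Finset.mem_powerset.2 hI)
end

section
/- Let H = (V, E) be a hypergraph in which every hyperedge is nonempty, every vertex belongs to at least one hyperedge, and the maximum cardinality α of a hyperedge satisfies α ≥ 2. Then ρ*(H) ≤ κ(H) ≤ (α/2)·ρ*(H). -/
open Finset

variable {α : Type*} [DecidableEq α]

/-- The minimum total weight of a fractional edge cover is attained. -/
lemma exists_coverWeights_eq_rhoStar (V : Finset α) (E : Finset (Finset α))
    (hcov : ∀ v ∈ V, ∃ e ∈ E, v ∈ e) :
    ∃ u : Finset α → ℝ, (∀ e, 0 ≤ u e) ∧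
      (∀ v ∈ V, 1 ≤ ∑ e ∈ E.filter (fun e => v ∈ e), u e) ∧
      rhoStar V E = ∑ e ∈ E, u e := by
  set K : Set (Finset α → ℝ) := Set.pi Set.univ (fun _ => Set.Icc 0 1) ∩
    {u | ∀ v ∈ V, 1 ≤ ∑ e ∈ E.filter (fun e => v ∈ e), u e}
  have hclosed : IsClosed
      {u : Finset α → ℝ | ∀ v ∈ V, 1 ≤ ∑ e ∈ E.filter (fun e => v ∈ e), u e} := by
    simp only [Set.ofPred_forall]
    exact isClosed_iInter fun v => isClosed_iInter fun _ =>
      isClosed_le continuous_const (by fun_prop)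
  have hKc : IsCompact K :=
    (isCompact_univ_pi fun _ => isCompact_Icc).inter_right hclosed
  have hKne : K.Nonempty := by
    refine ⟨fun _ => 1, fun _ _ => ⟨zero_le_one, le_rfl⟩, fun v hv => ?_⟩
    obtain ⟨e, he, hve⟩ := hcov v hv
    exact single_le_sum (f := fun _ : Finset α => (1 : ℝ)) (fun _ _ => zero_le_one)
      (mem_filter.2 ⟨he, hve⟩)
  obtain ⟨u, ⟨hu01, hucov⟩, humin⟩ := hKc.exists_isMinOn hKne
    (f := fun u : Finset α → ℝ => ∑ e ∈ E, u e) (by fun_prop)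
  have hu0 : ∀ e, 0 ≤ u e := fun e => (hu01 e (Set.mem_univ e)).1
  refine ⟨u, hu0, hucov, IsLeast.csInf_eq ⟨⟨u, fun e _ => hu0 e, hucov, rfl⟩, ?_⟩⟩
  rintro _ ⟨w, hw0, hwcov, rfl⟩
  have htrunc : (fun e => min (max (w e) 0) 1) ∈ K := by
    refine ⟨fun e _ => ⟨by positivity, min_le_right _ _⟩, fun v hv => ?_⟩
    by_cases hbig : ∃ e ∈ E.filter (fun e => v ∈ e), 1 ≤ w e
    · obtain ⟨e, he, hwe⟩ := hbig
      calc (1 : ℝ) ≤ min (max (w e) 0) 1 := le_min (hwe.trans (le_max_left _ _)) le_rfl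
        _ ≤ _ := single_le_sum (f := fun e => min (max (w e) 0) 1)
          (fun _ _ => by positivity) he
    · push Not at hbig
      refine (hwcov v hv).trans (sum_le_sum fun e he => ?_)
      exact le_min (le_max_left _ _) (hbig e he).le
  refine (isMinOn_iff.1 humin _ htrunc).trans (sum_le_sum fun e he => ?_)
  exact (min_le_left _ _).trans (max_le le_rfl (hw0 e he))

/-- Weak duality: double counting of vertex weights against an edge weighting. -/
lemma sum_mul_sum_filter_mem (V : Finset α) (E : Finset (Finset α)) (hE : ∀ e ∈ E, e ⊆ V)
    (u : Finset α → ℝ) (y : α → ℝ) :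
    ∑ v ∈ V, y v * ∑ e ∈ E.filter (fun e => v ∈ e), u e = ∑ e ∈ E, u e * ∑ v ∈ e, y v := by
  simp only [mul_sum]
  rw [sum_comm' (t' := E) (s' := fun e => e)]
  · simp only [mul_comm]
  · intro v e
    simp only [mem_filter]
    exact ⟨fun h => ⟨h.2.2, h.2.1⟩, fun h => ⟨hE e h.2 h.1, h.2, h.1⟩⟩

open scoped Pointwise in
/-- Strong duality: some fractional vertex packing has total weight at least `ρ*`. -/
lemma exists_vertexPacking_rhoStar_le (V : Finset α) (E : Finset (Finset α))
    (hE : ∀ e ∈ E, e ⊆ V) (hcov : ∀ v ∈ V, ∃ e ∈ E, v ∈ e) :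
    ∃ y : α → ℝ, (∀ v ∈ V, 0 ≤ y v) ∧ (∀ e ∈ E, ∑ v ∈ e, y v ≤ 1) ∧
      rhoStar V E ≤ ∑ v ∈ V, y v := by
  set ρ := rhoStar V E
  let L : (Finset α → ℝ) → (V → ℝ) × ℝ := fun u =>
    (fun v => ∑ e ∈ E.filter (fun e => v.1 ∈ e), u e, ∑ e ∈ E, u e)
  have hL : IsLinearMap ℝ L := by
    constructor
    · intro u w
      ext <;> simp [L, sum_add_distrib]
    · intro c u
      ext <;> simp [L, mul_sum]
  let O : Set ((V → ℝ) × ℝ) := (Set.pi Set.univ fun _ => Set.Iio 0) ×ˢ Set.Ioi 0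
  have hOo : IsOpen O :=
    (isOpen_set_pi Set.finite_univ fun _ _ => isOpen_Iio).prod isOpen_Ioi
  have hOc : Convex ℝ O := (convex_pi fun _ _ => convex_Iio 0).prod (convex_Ioi 0)
  have hA : Convex ℝ (L '' Set.Ici 0 + O) := ((convex_Ici 0).is_linear_image hL).add hOc
  have hnot : ((fun _ => 1, ρ) : (V → ℝ) × ℝ) ∉ L '' Set.Ici 0 + O := by
    rintro ⟨_, ⟨u, hu, rfl⟩, o, ho, hsum⟩
    have h2 := congrArg Prod.snd hsum
    have ho2 : 0 < o.2 := ho.2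
    simp only [L, Prod.snd_add] at h2
    have : ρ ≤ ∑ e ∈ E, u e := by
      refine csInf_le ⟨0, ?_⟩ ⟨u, fun e _ => hu e, fun v hv => ?_, rfl⟩
      · rintro _ ⟨w, hw, -, rfl⟩
        exact sum_nonneg hw
      · have h1 := congrFun (congrArg Prod.fst hsum) ⟨v, hv⟩
        have ho1 : o.1 ⟨v, hv⟩ < 0 := ho.1 _ (Set.mem_univ _)
        simp only [L, Prod.fst_add, Pi.add_apply] at h1
        linarith
    linarith
  obtain ⟨f, hf⟩ := geometric_hahn_banach_open_point hA hOo.add_left hnot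
  let z : V → ℝ := fun v => f (fun w => if v = w then 1 else 0, 0)
  let s : ℝ := f (0, 1)
  have hrep : ∀ x t, f (x, t) = ∑ v, x v * z v + t * s := by
    intro x t
    have h1 : f (x, 0) = ∑ v, x v * z v := by
      have := LinearMap.pi_apply_eq_sum_univ
        (f.toLinearMap ∘ₗ LinearMap.inl ℝ (V → ℝ) ℝ) x
      simpa [z] using this
    have h2 : f (0, t) = t * s := by
      have := f.map_smul t ((0 : V → ℝ), (1 : ℝ))
      simpa using this
    have h3 : ((x, t) : (V → ℝ) × ℝ) = (x, 0) + (0, t) := by simp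
    rw [h3, map_add, h1, h2]
  have hsep : ∀ u : Finset α → ℝ, (∀ e, 0 ≤ u e) → ∀ x : V → ℝ, (∀ v, x v < 0) →
      ∀ t, 0 < t → ∑ v : V, (∑ e ∈ E.filter (fun e => v.1 ∈ e), u e) * z v + (∑ e ∈ E, u e) * s +
        (∑ v, x v * z v + t * s) < ∑ v, z v + ρ * s := by
    intro u hu x hx t ht
    have := hf (L u + (x, t)) ⟨L u, ⟨u, hu, rfl⟩, (x, t), ⟨fun v _ => hx v, ht⟩, rfl⟩
    rw [map_add, hrep x t, hrep (fun _ => 1) ρ] at this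
    simpa [L, hrep] using this
  have hs : s < 0 := by
    let u : Finset α → ℝ := fun _ => 2
    have hc : ∀ v : V, (1 : ℝ) - ∑ e ∈ E.filter (fun e => v.1 ∈ e), u e < 0 := by
      intro v
      obtain ⟨e, he, hve⟩ := hcov v v.2
      have : (2 : ℝ) ≤ ∑ e ∈ E.filter (fun e => v.1 ∈ e), u e :=
        single_le_sum (f := u) (fun _ _ => by positivity) (mem_filter.2 ⟨he, hve⟩)
      linarith
    have h := hsep u (fun _ => by positivity) _ hc (|ρ| + 1) (by positivity)
    simp only [sub_mul, sum_sub_distrib, one_mul] at h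
    have hT : 0 ≤ ∑ e ∈ E, u e := sum_nonneg fun _ _ => by positivity
    have := le_abs_self ρ
    by_contra! hs
    nlinarith [mul_nonneg (sub_nonneg.2 this) hs, mul_nonneg hT hs]
  have hz : ∀ v, 0 ≤ z v := by
    intro v
    by_contra! hv
    set C := 2 * ∑ v, z v + ρ * s - s
    have hk : 0 ≤ |C| / (-z v) := div_nonneg (abs_nonneg _) (by linarith)
    have h := hsep 0 (fun _ => le_rfl) (fun w => -1 - (Pi.single v (|C| / (-z v)) : V → ℝ) w)
      (fun w => by
        have : 0 ≤ (Pi.single v (|C| / (-z v)) : V → ℝ) w := by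
          by_cases hw : w = v
          · subst hw; simpa using hk
          · simp [hw]
        linarith) 1 one_pos
    have h1 : ∑ w, (Pi.single v (|C| / (-z v)) : V → ℝ) w * z w = -|C| := by
      rw [sum_eq_single v]
      · rw [Pi.single_eq_same, div_neg, neg_mul, div_mul_cancel₀ _ hv.ne]
      · intro b _ hb; simp [hb]
      · simp
    simp only [Pi.zero_apply, sum_const_zero, zero_mul, sum_const_zero, sub_mul,
      sum_sub_distrib, h1, neg_mul, one_mul, sum_neg_distrib] at h
    have := le_abs_self C
    simp only [C] at this h
    linarith
  have hZ : 0 ≤ ∑ v, z v := sum_nonneg fun v _ => hz v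
  have hweak : ∀ u : Finset α → ℝ, (∀ e, 0 ≤ u e) →
      ∑ v : V, (∑ e ∈ E.filter (fun e => v.1 ∈ e), u e) * z v + (∑ e ∈ E, u e) * s ≤
        ∑ v, z v + ρ * s := by
    intro u hu
    by_contra! hlt
    have hD : 0 < ∑ v, z v - s := by linarith
    set δ := (∑ v : V, (∑ e ∈ E.filter (fun e => v.1 ∈ e), u e) * z v + (∑ e ∈ E, u e) * s -
      (∑ v, z v + ρ * s)) / (∑ v, z v - s) with hδ
    have hδ0 : 0 < δ := div_pos (by linarith) hD
    have h := hsep u hu (fun _ => -δ) (fun _ => by linarith) δ hδ0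
    rw [← mul_sum] at h
    have := div_mul_cancel₀ (∑ v : V, (∑ e ∈ E.filter (fun e => v.1 ∈ e), u e) * z v +
      (∑ e ∈ E, u e) * s - (∑ v, z v + ρ * s)) hD.ne'
    rw [← hδ] at this
    linarith
  let y : α → ℝ := fun v => if h : v ∈ V then z ⟨v, h⟩ / (-s) else 0
  have hy : ∀ v : V, y v = z v / (-s) := fun v => by simp [y]
  have hyz : ∀ g : α → ℝ, ∑ v : V, g v * z v = (∑ v ∈ V, y v * g v) * (-s) := by
    intro g
    rw [← sum_coe_sort V, sum_mul]
    refine sum_congr rfl fun v _ => ?_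
    rw [hy]
    field_simp [hs.ne]
  have hyV : ∑ v, z v = (∑ v ∈ V, y v) * (-s) := by simpa using hyz 1
  refine ⟨y, fun v hv => ?_, fun e he => ?_, ?_⟩
  · rw [hy ⟨v, hv⟩]
    exact div_nonneg (hz _) (by linarith)
  · by_contra! hlt
    set C := (∑ v ∈ V, y v) - ρ with hC
    have hd : 0 < ∑ v ∈ e, y v - 1 := by linarith
    set k := (|C| + 1) / (∑ v ∈ e, y v - 1) with hk
    have hk0 : 0 ≤ k := by positivity
    have h := hweak (Pi.single e k) (fun e' => by
      by_cases hw : e' = e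
      · subst hw; simpa using hk0
      · simp [hw])
    rw [hyz (fun v => ∑ e' ∈ E.filter (fun e => v ∈ e), (Pi.single e k : Finset α → ℝ) e'),
      sum_mul_sum_filter_mem V E hE, hyV] at h
    have h1 : ∑ e' ∈ E, (Pi.single e k : Finset α → ℝ) e' * ∑ v ∈ e', y v
        = k * ∑ v ∈ e, y v := by
      rw [sum_eq_single_of_mem e he]
      · simp
      · intro b _ hb; simp [hb]
    have h2 : ∑ e' ∈ E, (Pi.single e k : Finset α → ℝ) e' = k := by
      rw [sum_eq_single_of_mem e he]
      · simp
      · intro b _ hb; simp [hb]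
    rw [h1, h2] at h
    have h3 : k * (∑ v ∈ e, y v - 1) = |C| + 1 := div_mul_cancel₀ _ hd.ne'
    have h4 : (|C| + 1) * (-s) ≤ C * (-s) := by
      rw [← h3, hC]; linarith
    have h5 := le_of_mul_le_mul_right h4 (by linarith)
    linarith [le_abs_self C]
  · have h := hweak 0 fun _ => le_rfl
    simp only [Pi.zero_apply, sum_const_zero, zero_mul, add_zero, hyV] at h
    exact le_of_mul_le_mul_right (a := -s) (by linarith) (by linarith)

/-- Twice any fractional packing of `red(H[S])` is at most `a` times any fractional cover of `H`,
where `a ≥ 2` bounds the sizes of hyperedges. -/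
lemma two_mul_packing_le_mul_cover {V S : Finset α} {E : Finset (Finset α)}
    (hE : ∀ e ∈ E, e ⊆ V) (hS : S ⊆ V) {a : ℕ} (ha : ∀ e ∈ E, e.card ≤ a) (ha2 : 2 ≤ a)
    {p c : ℝ} (hp : p ∈ packingWeights S (reduce (induced E S))) (hc : c ∈ coverWeights V E) :
    2 * p ≤ a * c := by
  obtain ⟨u, hu0, hupack, rfl⟩ := hp
  obtain ⟨w, hw0, hwcov, rfl⟩ := hc
  set R := reduce (induced E S)
  have hRS : ∀ e ∈ R, e ⊆ S ∧ e.Nonempty := by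
    intro e he
    obtain ⟨hmem, h⟩ := mem_filter.1 (mem_filter.1 he).1
    obtain ⟨e', -, rfl⟩ := mem_image.1 hmem
    exact ⟨inter_subset_right, nonempty_iff_ne_empty.2 h⟩
  let y : α → ℝ := fun v => if v ∈ S then (if {v} ∈ R then 2 else 1) else 0
  have hy0 : ∀ v, 0 ≤ y v := fun v => by simp only [y]; split_ifs <;> norm_num
  have hlow : 2 * ∑ e ∈ R, u e ≤ ∑ v ∈ S, y v := by
    calc 2 * ∑ e ∈ R, u e ≤ ∑ e ∈ R, u e * ∑ v ∈ e, y v := by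
          rw [mul_sum]
          refine sum_le_sum fun e he => ?_
          rw [mul_comm]
          refine mul_le_mul_of_nonneg_left ?_ (hu0 e he)
          obtain ⟨heS, hne⟩ := hRS e he
          rcases (Nat.succ_le_of_lt hne.card_pos).lt_or_eq with h1 | h1
          · have : ∀ v ∈ e, (1 : ℝ) ≤ y v := fun v hv => by
              simp only [y, if_pos (heS hv)]; split_ifs <;> norm_num
            calc (2 : ℝ) ≤ e.card := by exact_mod_cast h1
              _ = ∑ v ∈ e, 1 := by simp
              _ ≤ _ := sum_le_sum this
          · obtain ⟨v, rfl⟩ := card_eq_one.1 h1.symm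
            simp [y, singleton_subset_iff.1 heS, he]
      _ = ∑ v ∈ S, y v * ∑ e ∈ R.filter (fun e => v ∈ e), u e :=
          (sum_mul_sum_filter_mem S R (fun e he => (hRS e he).1) u y).symm
      _ ≤ ∑ v ∈ S, y v :=
          sum_le_sum fun v hv => mul_le_of_le_one_right (hy0 v) (hupack v hv)
  have hup : ∑ v ∈ S, y v ≤ a * ∑ e ∈ E, w e := by
    calc ∑ v ∈ S, y v ≤ ∑ v ∈ V, y v := sum_le_sum_of_subset_of_nonneg hS fun v _ _ => hy0 v
      _ ≤ ∑ v ∈ V, y v * ∑ e ∈ E.filter (fun e => v ∈ e), w e :=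
          sum_le_sum fun v hv => le_mul_of_one_le_right (hy0 v) (hwcov v hv)
      _ = ∑ e ∈ E, w e * ∑ v ∈ e, y v := sum_mul_sum_filter_mem V E hE w y
      _ ≤ a * ∑ e ∈ E, w e := by
          rw [mul_sum]
          refine sum_le_sum fun e he => ?_
          rw [mul_comm]
          refine mul_le_mul_of_nonneg_right ?_ (hw0 e he)
          by_cases hsing : ∃ v ∈ e, v ∈ S ∧ {v} ∈ R
          · obtain ⟨v, hve, hvS, hv⟩ := hsing
            have hmax : {v} = e ∩ S := by
              refine (mem_filter.1 hv).2 _ ?_ ?_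
              · exact mem_filter.2 ⟨mem_image_of_mem _ he,
                  Finset.ne_empty_of_mem (mem_inter.2 ⟨hve, hvS⟩)⟩
              · exact singleton_subset_iff.2 (mem_inter.2 ⟨hve, hvS⟩)
            calc ∑ x ∈ e, y x = y v := by
                  refine sum_eq_single_of_mem v hve fun x hx hxv => if_neg fun hxS => hxv ?_
                  have : x ∈ ({v} : Finset α) := hmax ▸ mem_inter.2 ⟨hx, hxS⟩
                  exact mem_singleton.1 this
              _ = 2 := by simp [y, hvS, hv]
              _ ≤ a := by exact_mod_cast ha2
          · push Not at hsing
            calc ∑ x ∈ e, y x ≤ ∑ x ∈ e, 1 := by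
                  refine sum_le_sum fun x hx => ?_
                  by_cases hxS : x ∈ S
                  · simp [y, hxS, hsing x hx hxS]
                  · simp [y, hxS]
              _ = e.card := by simp
              _ ≤ a := by exact_mod_cast ha e he
  exact hlow.trans hup

/-- Some vertex set `S` has a fractional packing of `red(H[S])` of total weight `ρ*`: restrict an
optimal fractional edge cover to the support of an optimal fractional vertex packing. -/
lemma exists_rhoStar_mem_packingWeights (V : Finset α) (E : Finset (Finset α))
    (hE : ∀ e ∈ E, e ⊆ V) (hcov : ∀ v ∈ V, ∃ e ∈ E, v ∈ e) :
    ∃ S ⊆ V, rhoStar V E ∈ packingWeights S (reduce (induced E S)) := by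
  obtain ⟨u, hu0, hucov, hρ⟩ := exists_coverWeights_eq_rhoStar V E hcov
  obtain ⟨y, hy0, hypack, hyρ⟩ := exists_vertexPacking_rhoStar_le V E hE hcov
  have hdc := sum_mul_sum_filter_mem V E hE u y
  have h1 : ∀ v ∈ V, y v ≤ y v * ∑ e ∈ E.filter (fun e => v ∈ e), u e :=
    fun v hv => le_mul_of_one_le_right (hy0 v hv) (hucov v hv)
  have h2 : ∀ e ∈ E, u e * ∑ v ∈ e, y v ≤ u e :=
    fun e he => mul_le_of_le_one_right (hu0 e) (hypack e he)
  have h1' := sum_le_sum h1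
  have h2' := sum_le_sum h2
  have hvertex : ∀ v ∈ V, y v = y v * ∑ e ∈ E.filter (fun e => v ∈ e), u e :=
    (sum_eq_sum_iff_of_le h1).1 (by linarith)
  have hedge : ∀ e ∈ E, u e * ∑ v ∈ e, y v = u e :=
    (sum_eq_sum_iff_of_le h2).1 (by linarith)
  set S := V.filter fun v => 0 < y v
  have hsumS : ∀ e ∈ E, ∑ v ∈ e ∩ S, y v = ∑ v ∈ e, y v := by
    intro e he
    refine sum_subset inter_subset_left fun v hv hvS => ?_
    have hvV := hE e he hv
    have : ¬ 0 < y v := fun h => hvS (mem_inter.2 ⟨hv, mem_filter.2 ⟨hvV, h⟩⟩)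
    exact le_antisymm (not_lt.1 this) (hy0 v hvV)
  have htrace : ∀ e ∈ E, u e ≠ 0 → e ∩ S ∈ reduce (induced E S) := by
    intro e he hue
    have hone : ∑ v ∈ e ∩ S, y v = 1 := by
      rw [hsumS e he]
      exact mul_left_cancel₀ hue (by rw [hedge e he, mul_one])
    refine mem_filter.2 ⟨mem_filter.2 ⟨mem_image_of_mem _ he, ?_⟩, ?_⟩
    · intro h
      rw [h] at hone
      simp at hone
    · intro e' he' hsub
      obtain ⟨e₂, he₂, rfl⟩ := mem_image.1 (mem_filter.1 he').1
      by_contra hneq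
      obtain ⟨v, hv, hv'⟩ := exists_of_ssubset (hsub.ssubset_of_ne hneq)
      have hlt : ∑ v ∈ e ∩ S, y v < ∑ v ∈ e₂ ∩ S, y v :=
        sum_lt_sum_of_subset hsub hv hv' (mem_filter.1 (mem_inter.1 hv).2).2
          fun x hx _ => (mem_filter.1 (mem_inter.1 hx).2).2.le
      have := hypack e₂ he₂
      rw [hsumS e₂ he₂] at hlt
      linarith
  refine ⟨S, filter_subset _ _, fun t => ∑ e ∈ E.filter (fun e => e ∩ S = t), u e,
    fun t _ => sum_nonneg fun e _ => hu0 e, fun v hv => ?_, ?_⟩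
  · have hvpos := (mem_filter.1 hv).2
    have hone : ∑ e ∈ E.filter (fun e => v ∈ e), u e = 1 :=
      (mul_left_cancel₀ hvpos.ne' (by rw [← hvertex v (mem_filter.1 hv).1, mul_one]))
    rw [← hone, sum_comm' (t' := E.filter (fun e => v ∈ e ∧ e ∩ S ∈ reduce (induced E S)))
      (s' := fun e => {e ∩ S})]
    · simp only [sum_singleton]
      refine sum_le_sum_of_subset_of_nonneg (fun e he => ?_) fun e _ _ => hu0 e
      simp only [mem_filter] at he ⊢
      exact ⟨he.1, he.2.1⟩
    · intro t e
      simp only [mem_filter, mem_singleton]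
      constructor
      · rintro ⟨⟨ht, hvt⟩, he, rfl⟩
        exact ⟨rfl, he, (mem_inter.1 hvt).1, ht⟩
      · rintro ⟨rfl, he, hve, ht⟩
        exact ⟨⟨ht, mem_inter.2 ⟨hve, hv⟩⟩, he, rfl⟩
  · rw [hρ, sum_comm' (t' := E.filter (fun e => e ∩ S ∈ reduce (induced E S)))
      (s' := fun e => {e ∩ S})]
    · simp only [sum_singleton]
      exact (sum_filter_of_ne htrace).symm
    · intro t e
      simp only [mem_filter, mem_singleton]
      constructor
      · rintro ⟨ht, he, rfl⟩
        exact ⟨rfl, he, ht⟩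
      · rintro ⟨rfl, he, ht⟩
        exact ⟨ht, he, rfl⟩

/-- Let `H = (V, E)` be a hypergraph with nonempty hyperedges, in which
every vertex belongs to some hyperedge, and whose maximum hyperedge cardinality `a`
satisfies `a ≥ 2`. Then `ρ*(H) ≤ κ(H) ≤ (a/2)·ρ*(H)`. -/
theorem rhoStar_le_kappa_le (V : Finset α) (E : Finset (Finset α))
    (hE : ∀ e ∈ E, e ⊆ V) (hne : ∀ e ∈ E, e.Nonempty)
    (hcov : ∀ v ∈ V, ∃ e ∈ E, v ∈ e)
    (a : ℕ) (ha : a = E.sup Finset.card) (ha2 : 2 ≤ a) :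
    rhoStar V E ≤ kappa V E ∧ kappa V E ≤ (a / 2 : ℝ) * rhoStar V E := by
  have hcard : ∀ e ∈ E, e.card ≤ a := fun e he => ha ▸ le_sup (f := Finset.card) he
  have hbound : ∀ S ⊆ V, ∀ p ∈ packingWeights S (reduce (induced E S)),
      p ≤ (a / 2 : ℝ) * rhoStar V E := by
    intro S hS p hp
    obtain ⟨u, hu0, hucov, hρ⟩ := exists_coverWeights_eq_rhoStar V E hcov
    have := two_mul_packing_le_mul_cover hE hS hcard ha2 hp ⟨u, fun e _ => hu0 e, hucov, hρ⟩
    linarith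
  constructor
  · obtain ⟨S, hS, hmem⟩ := exists_rhoStar_mem_packingWeights V E hE hcov
    exact (le_csSup ⟨_, hbound S hS⟩ hmem).trans
      (le_sup' (fun S => tauStar S (reduce (induced E S))) (mem_powerset.2 hS))
  · refine sup'_le _ _ fun S hS => csSup_le ?_ (hbound S (mem_powerset.1 hS))
    exact ⟨0, fun _ => 0, by simp, by simp, by simp⟩
end

section
/- Let H = (V, E) be a hypergraph in which every hyperedge is nonempty and has at most 2 vertices, and in which every vertex belongs to at least one hyperedge. Then κ(H) = ρ*(H). -/
open Finset

variable {α : Type*} [DecidableEq α]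

/-- Von Neumann's minimax theorem in covering form: a nonnegative matrix without zero rows has a
feasible packing of its rows and a feasible cover by its columns of the same total weight. -/
theorem exists_packing_cover_sum_eq {ι κ : Type*} [Fintype ι] [Fintype κ] (A : ι → κ → ℝ)
    (hA : ∀ i j, 0 ≤ A i j) (hpos : ∀ i, ∃ j, 0 < A i j) :
    ∃ (x : ι → ℝ) (y : κ → ℝ), (∀ i, 0 ≤ x i) ∧ (∀ j, 0 ≤ y j) ∧
      (∀ j, ∑ i, x i * A i j ≤ 1) ∧ (∀ i, 1 ≤ ∑ j, y j * A i j) ∧ ∑ i, x i = ∑ j, y j := by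
  classical
  rcases isEmpty_or_nonempty ι with hι | ⟨⟨i₀⟩⟩
  · exact ⟨0, 0, by simp, by simp, by simp, fun i => isEmptyElim i, by simp⟩
  obtain ⟨j₀, -⟩ := hpos i₀
  let f : (ι → ℝ) → (κ → ℝ) → ℝ := fun x y => ∑ i, ∑ j, x i * A i j * y j
  have hfx (x : ι → ℝ) : IsLinearMap ℝ (f x) := by
    constructor
    · intro y z
      simp only [f, Pi.add_apply, mul_add, sum_add_distrib]
    · intro r y
      simp only [f, Pi.smul_apply, smul_eq_mul, mul_sum]
      exact sum_congr rfl fun i _ => sum_congr rfl fun j _ => by ring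
  have hfy (y : κ → ℝ) : IsLinearMap ℝ (fun x => f x y) := by
    constructor
    · intro x z
      simp only [f, Pi.add_apply, add_mul, sum_add_distrib]
    · intro r x
      simp only [f, Pi.smul_apply, smul_eq_mul, mul_sum]
      exact sum_congr rfl fun i _ => sum_congr rfl fun j _ => by ring
  have hcx (x : ι → ℝ) : Continuous (f x) := by fun_prop
  have hcy (y : κ → ℝ) : Continuous (fun x => f x y) := by fun_prop
  obtain ⟨a, ha, b, hb, hab⟩ := Sion.exists_isSaddlePointOn (f := f)
    (X := stdSimplex ℝ ι) (Y := stdSimplex ℝ κ)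
    ⟨_, single_mem_stdSimplex ℝ i₀⟩ (convex_stdSimplex ℝ ι) (isCompact_stdSimplex ℝ ι)
    (fun y _ => (hcy y).lowerSemicontinuous.lowerSemicontinuousOn _)
    (fun y _ => ((hfy y).mk' _ |>.convexOn (convex_stdSimplex ℝ ι)).quasiconvexOn)
    (convex_stdSimplex ℝ κ) ⟨_, single_mem_stdSimplex ℝ j₀⟩ (isCompact_stdSimplex ℝ κ)
    (fun x _ => (hcx x).upperSemicontinuous.upperSemicontinuousOn _)
    (fun x _ => ((hfx x).mk' _ |>.concaveOn (convex_stdSimplex ℝ κ)).quasiconcaveOn)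
  have hcol (j : κ) : ∑ i, a i * A i j ≤ f a b := by
    have h := hab a ha _ (single_mem_stdSimplex ℝ j)
    simpa [f, Pi.single_apply] using h
  have hrow (i : ι) : f a b ≤ ∑ j, b j * A i j := by
    have h := hab _ (single_mem_stdSimplex ℝ i) b hb
    simpa [f, Pi.single_apply, mul_comm] using h
  have hval : 0 < f a b := by
    obtain ⟨i, -, hi⟩ : ∃ i ∈ univ, 0 < a i :=
      exists_lt_of_sum_lt (by simp [ha.2] : ∑ _i : ι, (0 : ℝ) < ∑ i, a i)
    obtain ⟨j, hj⟩ := hpos i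
    refine lt_of_lt_of_le ?_ (hcol j)
    exact sum_pos' (fun k _ => mul_nonneg (ha.1 k) (hA k j)) ⟨i, mem_univ i, mul_pos hi hj⟩
  refine ⟨fun i => a i / f a b, fun j => b j / f a b, fun i => div_nonneg (ha.1 i) hval.le,
    fun j => div_nonneg (hb.1 j) hval.le, fun j => ?_, fun i => ?_, ?_⟩
  · simp only [div_mul_eq_mul_div, ← sum_div]
    exact (div_le_one hval).2 (hcol j)
  · simp only [div_mul_eq_mul_div, ← sum_div]
    exact (one_le_div hval).2 (hrow i)
  · simp only [← sum_div, ha.2, hb.2]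

/-- Double counting of incidences, weighted by vertex weights `x` and edge weights `u`. -/
theorem sum_mul_sum_incident {V : Finset α} {E : Finset (Finset α)} (hE : ∀ e ∈ E, e ⊆ V)
    (x : α → ℝ) (u : Finset α → ℝ) :
    ∑ v ∈ V, x v * ∑ e ∈ E with v ∈ e, u e = ∑ e ∈ E, u e * ∑ v ∈ e, x v := by
  simp only [mul_sum]
  rw [sum_comm' (t' := E) (s' := fun e => e)]
  · exact sum_congr rfl fun e _ => sum_congr rfl fun v _ => mul_comm _ _
  · intro v e
    simp only [mem_filter]
    exact ⟨fun h => ⟨h.2.2, h.2.1⟩, fun h => ⟨hE e h.2 h.1, h.2, h.1⟩⟩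

/-- Weak duality: a fractional vertex packing weighs at most as much as a fractional edge cover. -/
theorem sum_vertex_packing_le_sum_cover {V : Finset α} {E : Finset (Finset α)}
    (hE : ∀ e ∈ E, e ⊆ V) {x : α → ℝ} {u : Finset α → ℝ} (hx : ∀ v ∈ V, 0 ≤ x v)
    (hxE : ∀ e ∈ E, ∑ v ∈ e, x v ≤ 1) (hu : ∀ e ∈ E, 0 ≤ u e)
    (huV : ∀ v ∈ V, 1 ≤ ∑ e ∈ E with v ∈ e, u e) :
    ∑ v ∈ V, x v ≤ ∑ e ∈ E, u e :=
  calc ∑ v ∈ V, x v ≤ ∑ v ∈ V, x v * ∑ e ∈ E with v ∈ e, u e :=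
        sum_le_sum fun v hv => le_mul_of_one_le_right (hx v hv) (huV v hv)
    _ = ∑ e ∈ E, u e * ∑ v ∈ e, x v := sum_mul_sum_incident hE x u
    _ ≤ ∑ e ∈ E, u e := sum_le_sum fun e he => mul_le_of_le_one_right (hu e he) (hxE e he)

/-- Complementary slackness for a vertex packing and an edge cover of equal weight. -/
theorem complementary_slackness {V : Finset α} {E : Finset (Finset α)}
    (hE : ∀ e ∈ E, e ⊆ V) {x : α → ℝ} {u : Finset α → ℝ} (hx : ∀ v ∈ V, 0 ≤ x v)
    (hxE : ∀ e ∈ E, ∑ v ∈ e, x v ≤ 1) (hu : ∀ e ∈ E, 0 ≤ u e)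
    (huV : ∀ v ∈ V, 1 ≤ ∑ e ∈ E with v ∈ e, u e) (heq : ∑ v ∈ V, x v = ∑ e ∈ E, u e) :
    (∀ v ∈ V, 0 < x v → ∑ e ∈ E with v ∈ e, u e = 1) ∧
      ∀ e ∈ E, u e ≠ 0 → ∑ v ∈ e, x v = 1 := by
  have hV : ∀ v ∈ V, x v ≤ x v * ∑ e ∈ E with v ∈ e, u e :=
    fun v hv => le_mul_of_one_le_right (hx v hv) (huV v hv)
  have hE' : ∀ e ∈ E, u e * ∑ v ∈ e, x v ≤ u e :=
    fun e he => mul_le_of_le_one_right (hu e he) (hxE e he)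
  have hmid := sum_mul_sum_incident hE x u
  have hsV := (sum_eq_sum_iff_of_le hV).1
    (le_antisymm (sum_le_sum hV) (by rw [hmid, heq]; exact sum_le_sum hE'))
  have hsE := (sum_eq_sum_iff_of_le hE').1
    (le_antisymm (sum_le_sum hE') (by rw [← hmid, ← heq]; exact sum_le_sum hV))
  exact ⟨fun v hv h => (mul_eq_left₀ h.ne').1 (hsV v hv).symm,
    fun e he h => (mul_eq_left₀ h).1 (hsE e he)⟩

/-- Strong duality for fractional edge covers of a hypergraph without isolated vertices. -/
theorem exists_vertex_packing_cover_sum_eq {V : Finset α} {E : Finset (Finset α)}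
    (hE : ∀ e ∈ E, e ⊆ V) (hcov : ∀ v ∈ V, ∃ e ∈ E, v ∈ e) :
    ∃ (x : α → ℝ) (u : Finset α → ℝ), (∀ v ∈ V, 0 ≤ x v) ∧ (∀ e ∈ E, ∑ v ∈ e, x v ≤ 1) ∧
      (∀ e ∈ E, 0 ≤ u e) ∧ (∀ v ∈ V, 1 ≤ ∑ e ∈ E with v ∈ e, u e) ∧
      ∑ v ∈ V, x v = ∑ e ∈ E, u e := by
  obtain ⟨x, y, hx, hy, hxE, hyV, heq⟩ := exists_packing_cover_sum_eq
    (fun (v : V) (e : E) => if v.1 ∈ e.1 then (1 : ℝ) else 0)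
    (fun v e => by positivity)
    (fun v => by
      obtain ⟨e, he, hve⟩ := hcov v v.2
      exact ⟨⟨e, he⟩, by simp [hve]⟩)
  let x' : α → ℝ := fun v => if h : v ∈ V then x ⟨v, h⟩ else 0
  let u : Finset α → ℝ := fun e => if h : e ∈ E then y ⟨e, h⟩ else 0
  have hx' (v : V) : x' v = x v := by simp [x']
  have hu (e : E) : u e = y e := by simp [u]
  refine ⟨x', u, fun v hv => ?_, fun e he => ?_, fun e he => ?_, fun v hv => ?_, ?_⟩
  · rw [hx' ⟨v, hv⟩]
    exact hx _
  · have h := hxE ⟨e, he⟩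
    simp only [← hx', mul_ite, mul_one, mul_zero] at h
    rwa [sum_coe_sort V (fun v => if v ∈ e then x' v else 0), sum_ite_mem,
      inter_eq_right.2 (hE e he)] at h
  · rw [hu ⟨e, he⟩]
    exact hy _
  · have h := hyV ⟨v, hv⟩
    simp only [← hu, mul_ite, mul_one, mul_zero] at h
    rwa [sum_coe_sort E (fun e => if v ∈ e then u e else 0), ← sum_filter] at h
  · simp only [← hx', ← hu] at heq
    rwa [sum_coe_sort V x', sum_coe_sort E u] at heq

theorem mem_induced {E : Finset (Finset α)} {S f : Finset α} :
    f ∈ induced E S ↔ (∃ e ∈ E, e ∩ S = f) ∧ f ≠ ∅ := by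
  simp [induced]

/-- In a hypergraph of rank at most two, a fractional edge packing of a reduced induced
subhypergraph weighs at most as much as a fractional edge cover. -/
theorem packing_reduce_induced_le_sum_cover {V S : Finset α} {E : Finset (Finset α)}
    (hE : ∀ e ∈ E, e ⊆ V) (hcard : ∀ e ∈ E, e.card ≤ 2) (hS : S ⊆ V)
    {u : Finset α → ℝ} (hu : ∀ e ∈ E, 0 ≤ u e)
    (huV : ∀ v ∈ V, 1 ≤ ∑ e ∈ E with v ∈ e, u e) {w : ℝ}
    (hw : w ∈ packingWeights S (reduce (induced E S))) : w ≤ ∑ e ∈ E, u e := by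
  obtain ⟨p, hp, hpS, rfl⟩ := hw
  let R := reduce (induced E S)
  let y : α → ℝ := fun v => if {v} ∈ R then 1 else 1 / 2
  let x : α → ℝ := fun v => if v ∈ S then y v else 0
  have hy_half (v : α) : 1 / 2 ≤ y v := by
    simp only [y]; split_ifs <;> norm_num
  have hy_one (v : α) : y v ≤ 1 := by
    simp only [y]; split_ifs <;> norm_num
  have hRS : ∀ f ∈ R, f ⊆ S := by
    intro f hf
    obtain ⟨⟨e, -, rfl⟩, -⟩ := mem_induced.1 (mem_filter.1 hf).1
    exact inter_subset_right
  have hyR : ∀ f ∈ R, 1 ≤ ∑ v ∈ f, y v := by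
    intro f hf
    have hne : f.Nonempty := nonempty_iff_ne_empty.2 (mem_induced.1 (mem_filter.1 hf).1).2
    rcases (Nat.one_le_iff_ne_zero.2 hne.card_ne_zero).eq_or_lt with h | h
    · obtain ⟨v, rfl⟩ := card_eq_one.1 h.symm
      simp [y, hf]
    · have h2 : (2 : ℝ) ≤ f.card := by exact_mod_cast h
      have := card_nsmul_le_sum f y (1 / 2) fun v _ => hy_half v
      rw [nsmul_eq_mul] at this
      linarith
  have hxE : ∀ e ∈ E, ∑ v ∈ e, x v ≤ 1 := by
    intro e he
    have hc : (e ∩ S).card ≤ 2 := (card_le_card inter_subset_left).trans (hcard e he)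
    have hnotR : ∀ v ∈ e ∩ S, (e ∩ S).card = 2 → {v} ∉ R := by
      intro v hv h2 hR
      have heq := (mem_filter.1 hR).2 (e ∩ S)
        (mem_induced.2 ⟨⟨e, he, rfl⟩, ne_empty_of_mem hv⟩) (singleton_subset_iff.2 hv)
      simp [← heq] at h2
    rw [sum_ite_mem]
    rcases hc.lt_or_eq with h | h
    · have h1 : ((e ∩ S).card : ℝ) ≤ 1 := by exact_mod_cast Nat.lt_succ_iff.1 h
      have := sum_le_card_nsmul (e ∩ S) y 1 fun v _ => hy_one v
      rw [nsmul_eq_mul] at this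
      linarith
    · rw [sum_congr rfl fun v hv => if_neg (hnotR v hv h), sum_const, h]
      norm_num
  calc ∑ f ∈ R, p f ≤ ∑ f ∈ R, p f * ∑ v ∈ f, y v :=
        sum_le_sum fun f hf => le_mul_of_one_le_right (hp f hf) (hyR f hf)
    _ = ∑ v ∈ S, y v * ∑ f ∈ R with v ∈ f, p f := (sum_mul_sum_incident hRS y p).symm
    _ ≤ ∑ v ∈ S, y v := sum_le_sum fun v hv =>
        mul_le_of_le_one_right (by linarith [hy_half v]) (hpS v hv)
    _ = ∑ v ∈ V, x v := by rw [sum_ite_mem, inter_eq_right.2 hS]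
    _ ≤ ∑ e ∈ E, u e := sum_vertex_packing_le_sum_cover hE
        (fun v _ => by
          simp only [x]
          split_ifs
          · linarith [hy_half v]
          · rfl) hxE hu huV

/-- An optimal fractional edge cover restricts to a fractional edge packing of the reduced
subhypergraph induced by the support of an optimal fractional vertex packing. -/
theorem sum_cover_mem_packingWeights_support {V : Finset α} {E : Finset (Finset α)}
    (hE : ∀ e ∈ E, e ⊆ V) {x : α → ℝ} {u : Finset α → ℝ} (hx : ∀ v ∈ V, 0 ≤ x v)
    (hxE : ∀ e ∈ E, ∑ v ∈ e, x v ≤ 1) (hu : ∀ e ∈ E, 0 ≤ u e)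
    (huV : ∀ v ∈ V, 1 ≤ ∑ e ∈ E with v ∈ e, u e) (heq : ∑ v ∈ V, x v = ∑ e ∈ E, u e) :
    ∑ e ∈ E, u e ∈ packingWeights (V.filter fun v => 0 < x v)
      (reduce (induced E (V.filter fun v => 0 < x v))) := by
  obtain ⟨hsV, hsE⟩ := complementary_slackness hE hx hxE hu huV heq
  set S := V.filter fun v => 0 < x v
  have hxS : ∀ v ∈ S, 0 < x v := fun v hv => (mem_filter.1 hv).2
  have hsum : ∀ e ∈ E, ∑ v ∈ e ∩ S, x v = ∑ v ∈ e, x v := by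
    intro e he
    refine sum_subset inter_subset_left fun v hv hvS => ?_
    have hvV := hE e he hv
    refine le_antisymm (not_lt.1 fun h => hvS ?_) (hx v hvV)
    exact mem_inter.2 ⟨hv, mem_filter.2 ⟨hvV, h⟩⟩
  have htight : ∀ e ∈ E, u e ≠ 0 → e ∩ S ∈ reduce (induced E S) := by
    intro e he hue
    have h1 : ∑ v ∈ e ∩ S, x v = 1 := (hsum e he).trans (hsE e he hue)
    refine mem_filter.2 ⟨mem_induced.2 ⟨⟨e, he, rfl⟩, fun h => ?_⟩, ?_⟩
    · simp [h] at h1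
    · intro f hf hsub
      obtain ⟨⟨e', he', rfl⟩, -⟩ := mem_induced.1 hf
      by_contra hne
      obtain ⟨v, hv, hv'⟩ := exists_of_ssubset (hsub.ssubset_of_ne hne)
      have hlt : ∑ v ∈ e ∩ S, x v < ∑ v ∈ e' ∩ S, x v :=
        sum_lt_sum_of_subset hsub hv hv' (hxS v (mem_inter.1 hv).2)
          fun w hw _ => (hxS w (mem_inter.1 hw).2).le
      linarith [hsum e' he', hxE e' he']
  refine ⟨fun f => ∑ e ∈ E with e ∩ S = f, u e,
    fun f _ => sum_nonneg fun e he => hu e (mem_filter.1 he).1, fun v hv => ?_, ?_⟩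
  · rw [sum_fiberwise_eq_sum_filter, ← hsV v (mem_filter.1 hv).1 (hxS v hv)]
    refine sum_le_sum_of_subset_of_nonneg (fun e he => ?_)
      fun e he _ => hu e (mem_filter.1 he).1
    obtain ⟨he, h⟩ := mem_filter.1 he
    exact mem_filter.2 ⟨he, (mem_inter.1 (mem_filter.1 h).2).1⟩
  · rw [sum_fiberwise_eq_sum_filter, sum_filter_of_ne]
    exact htight

/-- If every hyperedge of `H = (V, E)` is nonempty with at most 2
vertices, and every vertex belongs to at least one hyperedge, then `κ(H) = ρ*(H)`. -/
theorem kappa_eq_rhoStar_of_binary (V : Finset α) (E : Finset (Finset α))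
    (hE : ∀ e ∈ E, e ⊆ V) (hne : ∀ e ∈ E, e.Nonempty)
    (hcard : ∀ e ∈ E, e.card ≤ 2)
    (hcov : ∀ v ∈ V, ∃ e ∈ E, v ∈ e) :
    kappa V E = rhoStar V E := by
  obtain ⟨x, u, hx, hxE, hu, huV, heq⟩ := exists_vertex_packing_cover_sum_eq hE hcov
  have hrho : rhoStar V E = ∑ e ∈ E, u e := by
    refine IsLeast.csInf_eq ⟨⟨u, hu, huV, rfl⟩, ?_⟩
    rintro w ⟨c, hc, hcV, rfl⟩
    rw [← heq]
    exact sum_vertex_packing_le_sum_cover hE hx hxE hc hcV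
  have hbound (S : Finset α) (hS : S ⊆ V) :
      ∑ e ∈ E, u e ∈ upperBounds (packingWeights S (reduce (induced E S))) :=
    fun _ hw => packing_reduce_induced_le_sum_cover hE hcard hS hu huV hw
  rw [hrho]
  refine le_antisymm (sup'_le _ _ fun S hS => ?_) ?_
  · exact csSup_le ⟨0, 0, by simp, by simp, by simp⟩ (hbound S (mem_powerset.1 hS))
  · have hS : (V.filter fun v => 0 < x v) ⊆ V := filter_subset _ _
    exact (le_csSup ⟨_, hbound _ hS⟩
      (sum_cover_mem_packingWeights_support hE hx hxE hu huV heq)).trans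
      (le_sup' (fun S => tauStar S (reduce (induced E S))) (mem_powerset.2 hS))
end

section
/- Let V be a finite set and let E be a finite collection of nonempty subsets of V. Suppose v* : V → ℝ minimizes Σ_{x ∈ V} v(x) over all v : V → ℝ satisfying v(x) ≥ 0 for all x ∈ V and Σ_{x ∈ R} v(x) ≥ 1 for every R ∈ E. Then v* also maximizes Σ_{x ∈ V} ψ(x) over all ψ : V → ℝ satisfying: ψ(x) ≥ 0 for all x ∈ V; ψ(x) ≤ 0 for every x with v*(x) = 0; and Σ_{x ∈ R} ψ(x) ≤ 1 for every R ∈ E such that Σ_{x ∈ R} v*(x) = 1. -/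
open Finset

open scoped Topology in
/-- A lower bound satisfied at `a` persists for a short time when moving in direction `d`,
provided that `d` is nonnegative if the bound is tight. -/
theorem eventually_le_add_mul {a b d : ℝ} (hab : b ≤ a) (hd : a = b → 0 ≤ d) :
    ∀ᶠ ε in 𝓝[>] (0 : ℝ), b ≤ a + ε * d := by
  rcases hab.eq_or_lt with h | h
  · filter_upwards [self_mem_nhdsWithin] with ε hε
    exact h.le.trans (le_add_of_nonneg_right (mul_nonneg (le_of_lt hε) (hd h.symm)))
  · have hcont : Filter.Tendsto (fun ε : ℝ => a + ε * d) (𝓝 0) (𝓝 (a + 0 * d)) :=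
      Continuous.tendsto (by fun_prop) 0
    rw [zero_mul, add_zero] at hcont
    exact ((hcont.eventually_const_lt h).filter_mono nhdsWithin_le_nhds).mono fun _ => le_of_lt

/-- Let `V` be a finite set and `E` a finite collection of nonempty
subsets of `V`. If `v*` minimizes `Σ_{x ∈ V} v(x)` over all nonnegative `v`
satisfying `Σ_{x ∈ R} v(x) ≥ 1` for every `R ∈ E`, then `v*` also maximizes
`Σ_{x ∈ V} ψ(x)` over all `ψ` satisfying: `ψ(x) ≥ 0` for all `x ∈ V`; `ψ(x) ≤ 0`
whenever `v*(x) = 0`; and `Σ_{x ∈ R} ψ(x) ≤ 1` for every `R ∈ E` that is tight at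
`v*` (i.e. with `Σ_{x ∈ R} v*(x) = 1`). -/
theorem optimal_cover_is_optimal_packing {α : Type*} [DecidableEq α]
    (V : Finset α) (E : Finset (Finset α))
    (hE : ∀ R ∈ E, R ⊆ V ∧ R.Nonempty)
    (vstar : α → ℝ)
    (hfeas : (∀ x ∈ V, 0 ≤ vstar x) ∧ (∀ R ∈ E, 1 ≤ ∑ x ∈ R, vstar x))
    (hmin : ∀ v : α → ℝ, (∀ x ∈ V, 0 ≤ v x) → (∀ R ∈ E, 1 ≤ ∑ x ∈ R, v x) →
      ∑ x ∈ V, vstar x ≤ ∑ x ∈ V, v x) :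
    ((∀ x ∈ V, 0 ≤ vstar x) ∧ (∀ x ∈ V, vstar x = 0 → vstar x ≤ 0) ∧
      (∀ R ∈ E, (∑ x ∈ R, vstar x) = 1 → ∑ x ∈ R, vstar x ≤ 1)) ∧
    (∀ ψ : α → ℝ, (∀ x ∈ V, 0 ≤ ψ x) → (∀ x ∈ V, vstar x = 0 → ψ x ≤ 0) →
      (∀ R ∈ E, (∑ x ∈ R, vstar x) = 1 → ∑ x ∈ R, ψ x ≤ 1) →
      ∑ x ∈ V, ψ x ≤ ∑ x ∈ V, vstar x) := by
  obtain ⟨hnonneg, hcover⟩ := hfeas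
  refine ⟨⟨hnonneg, fun x _ h => h.le, fun R _ h => h.le⟩, fun ψ _ hsupp htight => ?_⟩
  have hV : ∀ᶠ ε in nhdsWithin (0 : ℝ) (Set.Ioi 0), ∀ x ∈ V, 0 ≤ vstar x + ε * (vstar x - ψ x) :=
    (Filter.eventually_all_finset V).2 fun x hx =>
      eventually_le_add_mul (hnonneg x hx) fun h => by linarith [hsupp x hx h]
  have hR : ∀ᶠ ε in nhdsWithin (0 : ℝ) (Set.Ioi 0), ∀ R ∈ E,
      1 ≤ ∑ x ∈ R, vstar x + ε * (∑ x ∈ R, vstar x - ∑ x ∈ R, ψ x) :=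
    (Filter.eventually_all_finset E).2 fun R hR =>
      eventually_le_add_mul (hcover R hR) fun h => by linarith [htight R hR h]
  obtain ⟨ε, ⟨hεV, hεR⟩, hε⟩ := ((hV.and hR).and self_mem_nhdsWithin).exists
  have hsum (S : Finset α) : ∑ x ∈ S, (vstar x + ε * (vstar x - ψ x)) =
      ∑ x ∈ S, vstar x + ε * (∑ x ∈ S, vstar x - ∑ x ∈ S, ψ x) := by
    rw [Finset.sum_add_distrib, ← Finset.mul_sum, Finset.sum_sub_distrib]
  have hle := hmin _ hεV fun R hR => (hεR R hR).trans_eq (hsum R).symm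
  rw [hsum, le_add_iff_nonneg_right] at hle
  exact sub_nonneg.1 (nonneg_of_mul_nonneg_right hle hε)
end

section
/- Let Q be a finite set of relations such that every R ∈ Q satisfies its constraint set σ_R, and let v be a vertex weight mapping, for given reals n ≥ 1 and p ≥ 1, such that every subset U ⊆ vars(R) is consistent in R for every R ∈ Q. Let (U_1, R_1), …, (U_k, R_k) be pairs with R_j ∈ Q, U_j ⊆ vars(R_j), and U_j heavy in R_j for each j. Let H = U_1 ∪ … ∪ U_k and let R_H be the natural join of π_{U_1}(R_1), …, π_{U_k}(R_k). Then for every X ⊆ H, deg_{R_H}(H | X) ≤ 2^k · p^{Σ_{i ∈ H ∖ X} v_i}. -/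
open Finset

variable {α δ : Type*} [Fintype α] [DecidableEq α] [DecidableEq δ] [Inhabited δ]

/-- A tuple over a set `U` of attributes is modelled as a total function `α → δ`
supported on `U`: `restr U t` sets all attributes outside `U` to `default`. -/
def restr (U : Finset α) (t : α → δ) : α → δ := fun a => if a ∈ U then t a else default

/-- The projection `π_U(R)` of a relation `R` onto the attributes `U`. -/
def proj (U : Finset α) (R : Finset (α → δ)) : Finset (α → δ) := R.image (restr U)

/-- `degRel R Y X` is `deg_R(Y | X)`: the maximum, over tuples `x` over `X`, of the
number of tuples in `π_Y(R)` whose restriction to `X` equals `x`. -/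
def degRel (R : Finset (α → δ)) (Y X : Finset α) : ℕ :=
  (proj X R).sup (fun x => ((proj Y R).filter (fun t => restr X t = x)).card)

/-- The relation `R` with attribute set `vars` satisfies the constraint set `σ` if
`deg_R(Y | X) ≤ 2 σ(X) / σ(Y)` for all `X ⊆ Y ⊆ vars`. -/
def satisfiesConstraints (R : Finset (α → δ)) (vars : Finset α) (σ : Finset α → ℝ) : Prop :=
  ∀ X Y : Finset α, X ⊆ Y → Y ⊆ vars → (degRel R Y X : ℝ) ≤ 2 * σ X / σ Y

theorem restr_restr (A B : Finset α) (t : α → δ) : restr A (restr B t) = restr (A ∩ B) t := by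
  funext a
  by_cases hA : a ∈ A <;> by_cases hB : a ∈ B <;> simp [restr, hA, hB]

theorem restr_restr_of_subset {A B : Finset α} (h : A ⊆ B) (t : α → δ) :
    restr A (restr B t) = restr A t := by
  rw [restr_restr, inter_eq_left.mpr h]

theorem restr_union_eq {A B : Finset α} {s t : α → δ} (hA : restr A s = restr A t)
    (hB : restr B s = restr B t) : restr (A ∪ B) s = restr (A ∪ B) t := by
  funext a
  have h₁ := congrFun hA a
  have h₂ := congrFun hB a
  by_cases haA : a ∈ A <;> by_cases haB : a ∈ B <;> simp_all [restr]

/-- Every fibre of `π_Y(R) → π_X(R)` has at most `deg_R(Y | X)` elements. -/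
theorem card_filter_restr_le_degRel {R : Finset (α → δ)} {X : Finset α} (Y : Finset α)
    {x : α → δ} (hx : x ∈ proj X R) :
    ((proj Y R).filter (fun t => restr X t = x)).card ≤ degRel R Y X :=
  le_sup (f := fun x => ((proj Y R).filter (fun t => restr X t = x)).card) hx

/-- If the tuples of `S` project into `π_U(R)`, then extending the attributes `A` by `U`
multiplies the size of the projection of `S` by at most `deg_R(U | U ∩ A)`. -/
theorem card_proj_union_le {S R : Finset (α → δ)} (A U : Finset α)
    (hS : ∀ t ∈ S, restr U t ∈ proj U R) :
    (proj (A ∪ U) S).card ≤ degRel R U (U ∩ A) * (proj A S).card := by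
  have himage : (proj (A ∪ U) S).image (restr A) = proj A S := by
    rw [proj, proj, image_image]
    exact image_congr fun t _ => restr_restr_of_subset subset_union_left t
  rw [← himage]
  refine card_le_mul_card_image _ _ fun y hy => ?_
  rw [himage] at hy
  obtain ⟨t, htS, rfl⟩ := mem_image.mp hy
  have hmem : restr (U ∩ A) t ∈ proj (U ∩ A) R := by
    obtain ⟨u, huR, hu⟩ := mem_image.mp (hS t htS)
    refine mem_image.mpr ⟨u, huR, ?_⟩
    rw [← restr_restr_of_subset (inter_subset_left : U ∩ A ⊆ U) u, hu,
      restr_restr_of_subset inter_subset_left]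
  refine le_trans ?_ (card_filter_restr_le_degRel U hmem)
  refine card_le_card_of_injOn (restr U) ?_ ?_
  · intro s hs
    obtain ⟨hs, hst⟩ := mem_filter.mp hs
    obtain ⟨w, hwS, rfl⟩ := mem_image.mp hs
    rw [restr_restr_of_subset subset_union_left] at hst
    refine mem_filter.mpr ⟨?_, ?_⟩
    · rw [restr_restr_of_subset subset_union_right]
      exact hS w hwS
    · rw [restr_restr_of_subset subset_union_right, restr_restr_of_subset inter_subset_left,
        ← restr_restr_of_subset (inter_subset_right : U ∩ A ⊆ A) w, hst,
        restr_restr_of_subset inter_subset_right]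
  · intro s hs s' hs' hss
    obtain ⟨hs, hst⟩ := mem_filter.mp hs
    obtain ⟨hs', hst'⟩ := mem_filter.mp hs'
    obtain ⟨w, -, rfl⟩ := mem_image.mp hs
    obtain ⟨w', -, rfl⟩ := mem_image.mp hs'
    have := restr_union_eq (hst.trans hst'.symm) hss
    simpa only [restr_restr, inter_self] using this

/-- The degree of a heavy set over a consistent subset of it. -/
theorem degRel_le_of_heavy {R : Finset (α → δ)} {vars : Finset α} {σ : Finset α → ℝ}
    (hsat : satisfiesConstraints R vars σ) {n p : ℝ} (hn : 0 < n) (hp : 0 < p) {v : α → ℝ}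
    {X Y : Finset α} (hXY : X ⊆ Y) (hY : Y ⊆ vars)
    (hcons : σ X ≤ n / p ^ (∑ i ∈ X, v i)) (hheavy : n / p ^ (∑ i ∈ Y, v i) ≤ σ Y) :
    (degRel R Y X : ℝ) ≤ 2 * p ^ (∑ i ∈ Y \ X, v i) := by
  have hpX : 0 < p ^ (∑ i ∈ X, v i) := Real.rpow_pos_of_pos hp _
  have hpY : 0 < p ^ (∑ i ∈ Y, v i) := Real.rpow_pos_of_pos hp _
  calc (degRel R Y X : ℝ) ≤ 2 * σ X / σ Y := hsat X Y hXY hY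
    _ ≤ 2 * (n / p ^ (∑ i ∈ X, v i)) / (n / p ^ (∑ i ∈ Y, v i)) := by gcongr
    _ = 2 * p ^ (∑ i ∈ Y \ X, v i) := by
      rw [← sum_sdiff hXY, Real.rpow_add hp]
      field_simp

/-- Let `Q = {R_1, …, R_m}` be relations each satisfying its constraint
set `σ_j`, and let `v` be a vertex weight mapping (for reals `n ≥ 1`, `p ≥ 1`) such
that every subset of the attributes of every relation in `Q` is consistent. Given heavy
pairs `(U_1, R_{r 1}), …, (U_k, R_{r k})`, let `H = U_1 ∪ … ∪ U_k` and let `R_H` be the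
natural join of the projections `π_{U_j}(R_{r j})`. Then for every `X ⊆ H`,
`deg_{R_H}(H | X) ≤ 2^k · p^{Σ_{i ∈ H ∖ X} v_i}`. -/
theorem deg_heavy_relation_le
    (m : ℕ) (Rel : Fin m → Finset (α → δ)) (vars : Fin m → Finset α)
    (hsupp : ∀ j, ∀ t ∈ Rel j, restr (vars j) t = t)
    (σ : Fin m → Finset α → ℝ) (hσnonneg : ∀ j U, 0 ≤ σ j U)
    (hsat : ∀ j, satisfiesConstraints (Rel j) (vars j) (σ j))
    (n p : ℝ) (hn : 1 ≤ n) (hp : 1 ≤ p)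
    (v : α → ℝ) (hv : ∀ i, 0 ≤ v i)
    (hcons : ∀ j, ∀ U ⊆ vars j, σ j U ≤ n / p ^ (∑ i ∈ U, v i))
    (k : ℕ) (r : Fin k → Fin m) (U : Fin k → Finset α)
    (hU : ∀ j, U j ⊆ vars (r j))
    (hheavy : ∀ j, n / p ^ (∑ i ∈ U j, v i) ≤ σ (r j) (U j))
    (H : Finset α) (hH : H = Finset.univ.biUnion U)
    (RH : Finset (α → δ))
    (hRH : ∀ t : α → δ, t ∈ RH ↔
      (restr H t = t ∧ ∀ j, restr (U j) t ∈ proj (U j) (Rel (r j))))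
    (X : Finset α) (hX : X ⊆ H) :
    (degRel RH H X : ℝ) ≤ 2 ^ k * p ^ (∑ i ∈ H \ X, v i) := by
  have hn₀ : 0 < n := by linarith
  have hp₀ : 0 < p := by linarith
  have key (S : Finset (α → δ)) (hS : ∀ t ∈ S, ∀ j, restr (U j) t ∈ proj (U j) (Rel (r j)))
      (J : Finset (Fin k)) : ((proj (X ∪ J.biUnion U) S).card : ℝ) ≤
        2 ^ J.card * p ^ (∑ i ∈ J.biUnion U \ X, v i) * (proj X S).card := by
    induction J using Finset.induction_on with
    | empty => simp
    | insert j J hj ih =>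
      have hset : X ∪ (insert j J).biUnion U = (X ∪ J.biUnion U) ∪ U j := by
        rw [biUnion_insert, union_comm (U j), union_assoc]
      have hsum : ∑ i ∈ (insert j J).biUnion U \ X, v i =
          ∑ i ∈ U j \ (U j ∩ (X ∪ J.biUnion U)), v i + ∑ i ∈ J.biUnion U \ X, v i := by
        rw [← sum_union]
        · congr 1
          ext a
          simp only [biUnion_insert, mem_sdiff, mem_union, mem_inter]
          tauto
        · rw [disjoint_left]
          intro a
          simp only [mem_sdiff, mem_union, mem_inter]
          tauto
      have hdeg := degRel_le_of_heavy (v := v) (hsat (r j)) hn₀ hp₀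
        (inter_subset_left : U j ∩ (X ∪ J.biUnion U) ⊆ U j) (hU j)
        (hcons _ _ (inter_subset_left.trans (hU j))) (hheavy j)
      have hstep := card_proj_union_le (X ∪ J.biUnion U) (U j) fun t ht => hS t ht j
      rw [hset, hsum, card_insert_of_notMem hj, Real.rpow_add hp₀, pow_succ]
      calc ((proj ((X ∪ J.biUnion U) ∪ U j) S).card : ℝ)
          ≤ degRel (Rel (r j)) (U j) (U j ∩ (X ∪ J.biUnion U)) *
              (proj (X ∪ J.biUnion U) S).card := by exact_mod_cast hstep
        _ ≤ _ := mul_le_mul hdeg ih (by positivity) (by positivity)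
        _ = _ := by ring
  have hbound (x : α → δ) :
      (((proj H RH).filter (fun t => restr X t = x)).card : ℝ) ≤
        2 ^ k * p ^ (∑ i ∈ H \ X, v i) := by
    set S := (proj H RH).filter (fun t => restr X t = x)
    have hmem : ∀ t ∈ S, restr H t = t ∧ ∀ j, restr (U j) t ∈ proj (U j) (Rel (r j)) := by
      intro t ht
      obtain ⟨s, hs, rfl⟩ := mem_image.mp (mem_filter.mp ht).1
      rw [((hRH s).mp hs).1]
      exact (hRH s).mp hs
    have hXS : (proj X S).card ≤ 1 := by
      refine card_le_one_iff_subset_singleton.mpr ⟨x, ?_⟩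
      intro y hy
      obtain ⟨t, ht, rfl⟩ := mem_image.mp hy
      exact mem_singleton.mpr (mem_filter.mp ht).2
    have hHS : proj H S = S := by
      rw [proj, image_congr (g := id) fun t ht => (hmem t ht).1, image_id]
    have := key S (fun t ht => (hmem t ht).2) univ
    rw [← hH, union_eq_right.mpr hX, hHS, card_univ, Fintype.card_fin] at this
    refine this.trans (mul_le_of_le_one_right (by positivity) ?_)
    exact_mod_cast hXS
  have hne : (0 : ℝ) ≤ 2 ^ k * p ^ (∑ i ∈ H \ X, v i) := by positivity
  refine le_trans (Nat.cast_le.mpr (Finset.sup_le fun x _ => Nat.le_floor (hbound x))) ?_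
  exact Nat.floor_le hne
end
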